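/- arXiv:1410.6916 — 7 statements merged into one kernel-verified Lean document; each statement's English description precedes it below -/
import Mathlib

section
/- Let n be a positive integer with 4 dividing n(n+1)/2, and let 1 < p_1 ≤ p_2 ≤ p_3 ≤ p_4 be integers with p_1+p_2+p_3+p_4 = n. Then there exists an equitable partition of [n] implementing (p_1,p_2,p_3,p_4) if and only if Σ_{i=1}^{P_j} (n−i+1) ≥ j·s^{n,4} for all j = 1,2,3,4, where P_j = p_1+…+p_j. -/
open Finset

/-- `s^{n,k} = (n(n+1)/2)/k`. -/
def magicConst (n k : ℕ) : ℕ := (n * (n + 1) / 2) / k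

/-- `A` is a partition of `[n] = {1,…,n}` into `k` (indexed) parts. -/
def IsPartitionOn (n : ℕ) {k : ℕ} (A : Fin k → Finset ℕ) : Prop :=
  (∀ i j : Fin k, i ≠ j → Disjoint (A i) (A j)) ∧
    Finset.univ.biUnion A = Finset.Icc 1 n

/-- The partition `A` of `[n]` implements the sequence of sizes `p` (up to reindexing). -/
def Implements (n : ℕ) {k : ℕ} (A : Fin k → Finset ℕ) (p : Fin k → ℕ) : Prop :=
  IsPartitionOn n A ∧ ∃ e : Equiv.Perm (Fin k), ∀ i, (A (e i)).card = p i

/-- Every part of the partition has sum `s^{n,k}`. -/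
def Equitable (n : ℕ) {k : ℕ} (A : Fin k → Finset ℕ) : Prop :=
  ∀ i, (A i).sum id = magicConst n k

/-- `d(A) = Σ_i (S(A_i) − s^{n,k})²`. -/
def dVal (n : ℕ) {k : ℕ} (A : Fin k → Finset ℕ) : ℤ :=
  ∑ i : Fin k, ((((A i).sum id : ℕ) : ℤ) - (magicConst n k : ℤ)) ^ 2

/-- A partition implementing `p` minimizing `d` among all partitions implementing `p`. -/
def MinimalPartition (n : ℕ) {k : ℕ} (A : Fin k → Finset ℕ) (p : Fin k → ℕ) : Prop :=
  Implements n A p ∧ ∀ B : Fin k → Finset ℕ, Implements n B p → dVal n A ≤ dVal n B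

/-- Condition (★): `Σ_{i=1}^{P_j} (n−i+1) ≥ j·s^{n,k}` for all `j = 1,…,k`,
where `P_j = p_1 + ⋯ + p_j`. -/
def StarCond (n k : ℕ) (p : Fin k → ℕ) : Prop :=
  ∀ j : Fin k,
    ((j : ℕ) + 1) * magicConst n k ≤ ∑ i ∈ Finset.range (∑ t ∈ Finset.Iic j, p t), (n - i)

/-- The width `ω(A)` of a partition: the minimum of `y − x` over pairs `x < y` with `x`
in a low set and `y` in a high set (`⊤` if there is no such pair). -/
noncomputable def width (n : ℕ) {k : ℕ} (A : Fin k → Finset ℕ) : ℕ∞ :=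
  sInf { w : ℕ∞ | ∃ (x y : ℕ) (i j : Fin k), x ∈ A i ∧ y ∈ A j ∧ x < y ∧
    (A i).sum id < magicConst n k ∧ magicConst n k < (A j).sum id ∧ w = (y - x : ℕ) }

/-- `FeasibleSums n p t`: some colouring of `{1,…,n}` (shifted to `range n`) has, for every colour
`i`, exactly `p i` elements of colour `i`, with sum `t i`. -/
def FeasibleSums (n : ℕ) (p t : Fin 4 → ℤ) : Prop :=
  ∃ c : ℕ → Fin 4, ∀ i,
    ∑ x ∈ range n, (if c x = i then (1 : ℤ) else 0) = p i ∧
    ∑ x ∈ range n, (if c x = i then (x : ℤ) + 1 else 0) = t i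

/-- The largest possible sum of `∑ i ∈ J, p i` elements of `[n]`, minus the sum of the targets. -/
def slack (n : ℕ) (p t : Fin 4 → ℤ) (J : Finset (Fin 4)) : ℤ :=
  (∑ i ∈ J, p i) * (2 * n + 1 - ∑ i ∈ J, p i) / 2 - ∑ i ∈ J, t i

/-- The obvious necessary conditions for `FeasibleSums n p t`. -/
structure Admissible (n : ℕ) (p t : Fin 4 → ℤ) : Prop where
  nonneg : ∀ i, 0 ≤ p i
  sum_sizes : ∑ i, p i = n
  sum_targets : 2 * ∑ i, t i = n * (n + 1)
  slack_nonneg : ∀ J, 0 ≤ slack n p t J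

theorem two_mul_slack (n : ℕ) (p t : Fin 4 → ℤ) (J : Finset (Fin 4)) :
    2 * slack n p t J =
      (∑ i ∈ J, p i) * (2 * n + 1 - ∑ i ∈ J, p i) - 2 * ∑ i ∈ J, t i := by
  unfold slack
  generalize ∑ i ∈ J, p i = P
  have h : (2 : ℤ) ∣ P * (2 * n + 1 - P) := by
    rcases Int.even_or_odd' P with ⟨k, rfl | rfl⟩
    · exact ⟨k * (2 * n + 1 - 2 * k), by ring⟩
    · exact ⟨(2 * k + 1) * (n - k), by ring⟩
  have := Int.mul_ediv_cancel' h
  linarith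

theorem slack_add_slack (n : ℕ) (p t : Fin 4 → ℤ) (A B : Finset (Fin 4)) :
    slack n p t A + slack n p t B = slack n p t (A ∩ B) + slack n p t (A ∪ B) +
      (∑ i ∈ A \ B, p i) * (∑ i ∈ B \ A, p i) := by
  have hA (f : Fin 4 → ℤ) : ∑ i ∈ A, f i = ∑ i ∈ A \ B, f i + ∑ i ∈ A ∩ B, f i := by
    rw [← sum_inter_add_sum_sdiff A B]; ring
  have hB (f : Fin 4 → ℤ) : ∑ i ∈ B, f i = ∑ i ∈ B \ A, f i + ∑ i ∈ A ∩ B, f i := by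
    rw [← sum_inter_add_sum_sdiff B A, inter_comm]; ring
  have hU (f : Fin 4 → ℤ) :
      ∑ i ∈ A ∪ B, f i = ∑ i ∈ A \ B, f i + ∑ i ∈ B \ A, f i + ∑ i ∈ A ∩ B, f i := by
    have := sum_union_inter (s₁ := A) (s₂ := B) (f := f)
    have h1 := hA f
    have h2 := hB f
    linarith
  have h1 := two_mul_slack n p t A
  have h2 := two_mul_slack n p t B
  have h3 := two_mul_slack n p t (A ∩ B)
  have h4 := two_mul_slack n p t (A ∪ B)
  rw [hA p, hA t] at h1
  rw [hB p, hB t] at h2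
  rw [hU p, hU t] at h4
  linarith

namespace FeasibleSums

theorem append {a b : ℕ} {p t q u : Fin 4 → ℤ} (h₁ : FeasibleSums a p t)
    (h₂ : FeasibleSums b q u) :
    FeasibleSums (a + b) (fun i => p i + q i) (fun i => t i + (u i + a * q i)) := by
  obtain ⟨c, hc⟩ := h₁
  obtain ⟨d, hd⟩ := h₂
  refine ⟨fun x => if x < a then c x else d (x - a), fun i => ?_⟩
  have hlow (g : ℕ → ℤ) : ∑ x ∈ range a, (if (if x < a then c x else d (x - a)) = i
      then g x else 0) = ∑ x ∈ range a, if c x = i then g x else 0 :=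
    sum_congr rfl fun x hx => by rw [if_pos (mem_range.1 hx)]
  have hhigh (g : ℕ → ℤ) : ∑ x ∈ range b, (if (if a + x < a then c (a + x) else d (a + x - a)) = i
      then g (a + x) else 0) = ∑ x ∈ range b, if d x = i then g (a + x) else 0 :=
    sum_congr rfl fun x _ => by rw [if_neg (show ¬ a + x < a by omega), Nat.add_sub_cancel_left]
  constructor
  · rw [sum_range_add, hlow fun _ => 1, hhigh fun _ => 1, (hc i).1, (hd i).1]
  · rw [sum_range_add, hlow fun x => (x : ℤ) + 1, hhigh fun x => (x : ℤ) + 1, (hc i).2]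
    congr 1
    rw [← (hd i).2, ← (hd i).1, mul_sum, ← sum_add_distrib]
    refine sum_congr rfl fun x _ => ?_
    split_ifs
    · push_cast; ring
    · ring

theorem reflect {n : ℕ} {p t : Fin 4 → ℤ}
    (h : FeasibleSums n p (fun i => (n + 1) * p i - t i)) : FeasibleSums n p t := by
  obtain ⟨c, hc⟩ := h
  refine ⟨fun x => c (n - 1 - x), fun i => ⟨?_, ?_⟩⟩
  · rw [← (hc i).1]
    exact sum_range_reflect (fun x => if c x = i then (1 : ℤ) else 0) n
  · have h1 := (hc i).1
    have h2 := (hc i).2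
    rw [← sum_range_reflect] at h2
    rw [← sum_range_reflect] at h1
    have : ∑ x ∈ range n, (if c (n - 1 - x) = i then (x : ℤ) + 1 else 0) =
        (n + 1) * ∑ x ∈ range n, (if c (n - 1 - x) = i then (1 : ℤ) else 0) -
          ∑ x ∈ range n, (if c (n - 1 - x) = i then ((n - 1 - x : ℕ) : ℤ) + 1 else 0) := by
      rw [mul_sum, ← sum_sub_distrib]
      refine sum_congr rfl fun x hx => ?_
      have hx := mem_range.1 hx
      split_ifs
      · rw [Nat.cast_sub (by omega), Nat.cast_sub (by omega)]; push_cast; ring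
      · ring
    rw [this, h1, h2]
    ring

theorem comp_equiv {n : ℕ} {p t : Fin 4 → ℤ} (e : Equiv.Perm (Fin 4))
    (h : FeasibleSums n (p ∘ e) (t ∘ e)) : FeasibleSums n p t := by
  obtain ⟨c, hc⟩ := h
  refine ⟨fun x => e (c x), fun i => ?_⟩
  have := hc (e.symm i)
  simpa [Equiv.eq_symm_apply] using this

theorem singleton (i : Fin 4) :
    FeasibleSums 1 (fun k => if k = i then 1 else 0) (fun k => if k = i then 1 else 0) :=
  ⟨fun _ => i, fun k => by simp [eq_comm]⟩

/-- The block `{1,…,m+1}`, all of colour `i` except that `s + 1` has colour `j`. -/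
theorem block {m s : ℕ} {i j : Fin 4} (hij : i ≠ j) (hs : s ≤ m) :
    FeasibleSums (m + 1) (fun k => (if k = i then (m : ℤ) else 0) + if k = j then 1 else 0)
      (fun k => (if k = i then ((m : ℤ) + 1) * (m + 2) / 2 - (s + 1) else 0) +
        if k = j then (s : ℤ) + 1 else 0) := by
  refine ⟨fun x => if x = s then j else i, fun k => ?_⟩
  have hmem : s ∈ range (m + 1) := mem_range.2 (by omega)
  have hsum (g : ℕ → ℤ) : ∑ x ∈ range (m + 1), (if (if x = s then j else i) = k then g x else 0) =
      (if k = i then ∑ x ∈ range (m + 1), g x - g s else 0) + if k = j then g s else 0 := by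
    rw [← add_sum_erase _ _ hmem, ← add_sum_erase _ g hmem, if_pos rfl]
    have : ∑ x ∈ (range (m + 1)).erase s, (if (if x = s then j else i) = k then g x else 0) =
        ∑ x ∈ (range (m + 1)).erase s, if i = k then g x else 0 :=
      sum_congr rfl fun x hx => by rw [if_neg (ne_of_mem_erase hx)]
    rw [this]
    by_cases h1 : i = k
    · subst h1; simp [hij.symm]
      intro h; exact absurd h hij
    · by_cases h2 : j = k
      · subst h2; simp [hij]
        intro h; exact absurd h.symm hij
      · simp [h1, h2, Ne.symm h1, Ne.symm h2]
  refine ⟨?_, ?_⟩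
  · rw [hsum fun _ => 1]; simp
  · rw [hsum fun x => (x : ℤ) + 1]
    have : ∑ x ∈ range (m + 1), ((x : ℤ) + 1) = ((m : ℤ) + 1) * (m + 2) / 2 := by
      refine (Int.ediv_eq_of_eq_mul_right two_ne_zero ?_).symm
      clear hsum hmem hs
      induction m with
      | zero => simp
      | succ m ih => rw [sum_range_succ]; push_cast at ih ⊢; linarith
    rw [this]

end FeasibleSums

namespace Admissible

variable {n : ℕ} {p t : Fin 4 → ℤ}

theorem sum_nonneg (h : Admissible n p t) (J : Finset (Fin 4)) : 0 ≤ ∑ i ∈ J, p i :=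
  Finset.sum_nonneg fun i _ => h.nonneg i

theorem slack_univ (h : Admissible n p t) : slack n p t univ = 0 := by
  have h1 := two_mul_slack n p t univ
  rw [h.sum_sizes, h.sum_targets] at h1
  linarith

theorem slack_reflect (h : Admissible n p t) (J : Finset (Fin 4)) :
    slack n p (fun i => (n + 1) * p i - t i) J = slack n p t Jᶜ := by
  have h1 := two_mul_slack n p (fun i => (n + 1) * p i - t i) J
  have h2 := two_mul_slack n p t Jᶜ
  have h3 := sum_add_sum_compl J p
  have h4 := sum_add_sum_compl J t
  have h5 := h.sum_targets
  rw [h.sum_sizes] at h3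
  rw [← h4] at h5
  rw [sum_sub_distrib, ← mul_sum] at h1
  have h6 : ∑ i ∈ Jᶜ, p i = n - ∑ i ∈ J, p i := by linarith
  rw [h6] at h2
  linarith

theorem reflect (h : Admissible n p t) : Admissible n p (fun i => (n + 1) * p i - t i) where
  nonneg := h.nonneg
  sum_sizes := h.sum_sizes
  sum_targets := by
    have h1 := h.sum_targets
    rw [sum_sub_distrib, ← mul_sum, h.sum_sizes]
    linarith
  slack_nonneg J := by rw [h.slack_reflect]; exact h.slack_nonneg _

theorem target_eq_zero (h : Admissible n p t) {i : Fin 4} (hi : p i = 0) : t i = 0 := by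
  have h1 := two_mul_slack n p t {i}
  have h2 := two_mul_slack n p (fun i => (n + 1) * p i - t i) {i}
  have h3 := h.slack_nonneg {i}
  have h4 := h.reflect.slack_nonneg {i}
  simp only [sum_singleton, hi] at h1 h2
  linarith

theorem comp_equiv (h : Admissible n p t) (e : Equiv.Perm (Fin 4)) :
    Admissible n (p ∘ e) (t ∘ e) where
  nonneg i := h.nonneg _
  sum_sizes := by rw [← h.sum_sizes]; exact Equiv.sum_comp e p
  sum_targets := by rw [← h.sum_targets]; congr 1; exact Equiv.sum_comp e t
  slack_nonneg J := by
    have := h.slack_nonneg (J.map e.toEmbedding)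
    simpa [slack] using this

/-- Assigning the largest element to colour `i`. -/
theorem erase_max {i : Fin 4} (h : Admissible (n + 1) p t) (hi : 1 ≤ p i)
    (hJ : ∀ J, i ∉ J → ∑ k ∈ J, p k ≤ slack (n + 1) p t J) :
    Admissible n (fun k => p k - if k = i then 1 else 0)
      (fun k => t k - if k = i then (n : ℤ) + 1 else 0) where
  nonneg k := by
    have := h.nonneg k
    split_ifs with hk
    · subst hk; linarith
    · linarith
  sum_sizes := by
    have := h.sum_sizes
    simp only [sum_sub_distrib, sum_ite_eq', mem_univ, if_true]
    push_cast at this; linarith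
  sum_targets := by
    have := h.sum_targets
    simp only [sum_sub_distrib, sum_ite_eq', mem_univ, if_true]
    push_cast at this; linarith
  slack_nonneg J := by
    have h1 := two_mul_slack n (fun k => p k - if k = i then 1 else 0)
      (fun k => t k - if k = i then (n : ℤ) + 1 else 0) J
    have h2 := two_mul_slack (n + 1) p t J
    have h3 := h.slack_nonneg J
    simp only [sum_sub_distrib, sum_ite_eq'] at h1
    push_cast at h2
    by_cases hiJ : i ∈ J
    · simp only [if_pos hiJ] at h1
      linarith
    · have h4 := hJ J hiJ
      simp only [if_neg hiJ] at h1
      linarith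

end Admissible

theorem FeasibleSums.of_erase_max {n : ℕ} {p t : Fin 4 → ℤ} {i : Fin 4}
    (h : FeasibleSums n (fun k => p k - if k = i then 1 else 0)
      (fun k => t k - if k = i then (n : ℤ) + 1 else 0)) : FeasibleSums (n + 1) p t := by
  have := h.append (FeasibleSums.singleton i)
  convert this using 1
  · funext k; ring
  · funext k
    split_ifs <;> ring

namespace Admissible

variable {n : ℕ} {p t : Fin 4 → ℤ}

theorem slack_empty : slack n p t ∅ = 0 := by simp [slack]

/-- A colour whose singleton is nearly tight can always receive the largest element. -/
theorem sum_le_slack_of_singleton (h : Admissible n p t) {i : Fin 4}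
    (hi : slack n p t {i} < p i) {J : Finset (Fin 4)} (hJ : i ∉ J) :
    ∑ k ∈ J, p k ≤ slack n p t J := by
  by_contra! hlt
  have h1 := slack_add_slack n p t {i} J
  rw [singleton_inter_of_notMem hJ, slack_empty, sdiff_singleton_eq_erase, erase_eq_of_notMem hJ,
    sdiff_eq_self_of_disjoint (disjoint_singleton_left.2 hJ), sum_singleton] at h1
  have h2 := h.slack_nonneg ({i} ∪ J)
  have h3 := h.slack_nonneg J
  have h4 := h.slack_nonneg {i}
  nlinarith

/-- If no singleton is nearly tight, each colour of size at least two can receive the largest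
element or the smallest one. -/
theorem sum_le_slack_or (h : Admissible n p t) (htop : ∀ i, p i ≤ slack n p t {i})
    (hbot : ∀ i, p i ≤ slack n p t {i}ᶜ) {i : Fin 4} (hi : 2 ≤ p i) :
    (∀ J, i ∉ J → ∑ k ∈ J, p k ≤ slack n p t J) ∨
      (∀ J, i ∉ J → ∑ k ∈ J, p k ≤ slack n p t Jᶜ) := by
  by_contra! hcon
  obtain ⟨⟨A, hiA, hA⟩, B, hiB, hB⟩ := hcon
  have small_top (S : Finset (Fin 4)) (hS : S.card ≤ 1) : ∑ k ∈ S, p k ≤ slack n p t S := by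
    rcases Nat.le_one_iff_eq_zero_or_eq_one.1 hS with h0 | h1
    · rw [card_eq_zero.1 h0, slack_empty, sum_empty]
    · obtain ⟨a, rfl⟩ := card_eq_one.1 h1
      simpa using htop a
  have small_bot (S : Finset (Fin 4)) (hS : S.card ≤ 1) : ∑ k ∈ S, p k ≤ slack n p t Sᶜ := by
    rcases Nat.le_one_iff_eq_zero_or_eq_one.1 hS with h0 | h1
    · rw [card_eq_zero.1 h0, compl_empty, h.slack_univ, sum_empty]
    · obtain ⟨a, rfl⟩ := card_eq_one.1 h1
      simpa using hbot a
  have hAc : 2 ≤ A.card := by by_contra! hc; linarith [small_top A (by omega)]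
  have hBc : 2 ≤ B.card := by by_contra! hc; linarith [small_bot B (by omega)]
  have hU : (A ∪ B).card ≤ 3 := by
    have : (A ∪ B) ⊆ univ.erase i := fun x hx =>
      mem_erase.2 ⟨fun hxi => by subst hxi; simp_all, mem_univ _⟩
    simpa using card_le_card this
  have h1 := card_sdiff_add_card A B
  have h2 := card_sdiff_add_card B A
  rw [union_comm B A] at h2
  have hdA := small_top (A \ B) (by omega)
  have hdB := small_bot (B \ A) (by omega)
  have hun := slack_add_slack n p t A Bᶜ
  have e1 : A ∩ Bᶜ = A \ B := by ext; simp
  have e2 : A ∪ Bᶜ = (B \ A)ᶜ := by ext; simp; tauto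
  have e3 : A \ Bᶜ = A ∩ B := by ext; simp
  have e4 : Bᶜ \ A = (A ∪ B)ᶜ := by ext; simp [and_comm]
  rw [e1, e2, e3, e4] at hun
  have hr : 2 ≤ ∑ k ∈ (A ∪ B)ᶜ, p k := by
    refine hi.trans (single_le_sum (f := p) (fun k _ => h.nonneg k) ?_)
    simp [hiA, hiB]
  have he := h.sum_nonneg (A ∩ B)
  have hsA := sum_inter_add_sum_sdiff A B p
  have hsB := sum_inter_add_sum_sdiff B A p
  rw [inter_comm B A] at hsB
  nlinarith

/-- Filling the colour `i` using all but one of the `p i + 1` largest elements, and giving the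
remaining one to the colour `j`. -/
theorem erase_block {N m s : ℕ} {i j : Fin 4} (h : Admissible (N + (m + 1)) p t) (hij : i ≠ j)
    (hi : p i = m) (hj : 1 ≤ p j) (hs : slack (N + (m + 1)) p t {i} = s)
    (hK : ∀ K, i ∉ K → j ∉ K →
      ∑ k ∈ K, p k + s ≤ slack (N + (m + 1)) p t (insert i K)) :
    Admissible N (fun k => if k = i then 0 else p k - if k = j then 1 else 0)
      (fun k => if k = i then 0 else t k - if k = j then (N : ℤ) + s + 1 else 0) := by
  have hti := two_mul_slack (N + (m + 1)) p t {i}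
  rw [hs, sum_singleton, sum_singleton, hi] at hti
  push_cast at hti
  have hsum (f : Fin 4 → ℤ) (a : ℤ) (J : Finset (Fin 4)) :
      ∑ k ∈ J, (if k = i then 0 else f k - if k = j then a else 0) =
        ∑ k ∈ J.erase i, f k - if j ∈ J.erase i then a else 0 := by
    rw [← sum_ite_eq' (J.erase i) j fun _ => a, ← sum_sub_distrib]
    by_cases hiJ : i ∈ J
    · rw [← add_sum_erase _ _ hiJ, if_pos rfl, zero_add]
      exact sum_congr rfl fun k hk => if_neg (ne_of_mem_erase hk)
    · rw [erase_eq_of_notMem hiJ]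
      exact sum_congr rfl fun k hk => if_neg fun hki : k = i => hiJ (hki ▸ hk)
  have hju : j ∈ univ.erase i := mem_erase.2 ⟨hij.symm, mem_univ _⟩
  have hp := h.sum_sizes
  have ht := h.sum_targets
  rw [← add_sum_erase _ _ (mem_univ i)] at hp ht
  push_cast at hp ht
  refine ⟨fun k => ?_, ?_, ?_, fun J => ?_⟩
  · have := h.nonneg k
    split_ifs with h1 h2
    · exact le_rfl
    · subst h2; linarith
    · linarith
  · rw [hsum, if_pos hju]
    linarith
  · rw [hsum, if_pos hju]
    linarith
  · have h1 := two_mul_slack N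
      (fun k => if k = i then 0 else p k - if k = j then 1 else 0)
      (fun k => if k = i then 0 else t k - if k = j then (N : ℤ) + s + 1 else 0) J
    rw [hsum, hsum] at h1
    have hni : i ∉ J.erase i := notMem_erase i J
    generalize J.erase i = K at h1 hni
    have h2 := two_mul_slack (N + (m + 1)) p t (insert i K)
    rw [sum_insert hni, sum_insert hni, hi] at h2
    push_cast at h2
    by_cases hjK : j ∈ K
    · rw [if_pos hjK, if_pos hjK] at h1
      have h3 := h.slack_nonneg (insert i K)
      linarith
    · rw [if_neg hjK, if_neg hjK] at h1
      have h3 := hK K hni hjK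
      linarith

end Admissible

theorem FeasibleSums.of_erase_block {N m s : ℕ} {p t : Fin 4 → ℤ} {i j : Fin 4} (hij : i ≠ j)
    (hi : p i = m) (hsm : s ≤ m) (hs : slack (N + (m + 1)) p t {i} = s)
    (h : FeasibleSums N (fun k => if k = i then 0 else p k - if k = j then 1 else 0)
      (fun k => if k = i then 0 else t k - if k = j then (N : ℤ) + s + 1 else 0)) :
    FeasibleSums (N + (m + 1)) p t := by
  have hti := two_mul_slack (N + (m + 1)) p t {i}
  rw [hs, sum_singleton, sum_singleton, hi] at hti
  push_cast at hti
  have hdiv : 2 * (((m : ℤ) + 1) * (m + 2) / 2) = ((m : ℤ) + 1) * (m + 2) :=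
    Int.mul_ediv_cancel' (by
      have := (Int.even_mul_succ_self ((m : ℤ) + 1)).two_dvd
      rwa [add_assoc] at this)
  convert h.append (FeasibleSums.block hij hsm) using 1
  · funext k
    by_cases hk : k = i
    · subst hk; simp [hij, hi]
    · simp [hk]
  · funext k
    by_cases hk : k = i
    · subst hk; simp only [if_true, if_neg hij]; linarith
    · simp only [if_neg hk]
      split_ifs <;> ring

/-- Necessary condition for `p` distinct elements of `[n]` to have sum `t`. -/
def sumInRange (n p t : ℕ) : Bool :=
  Nat.ble (p * (p + 1)) (2 * t) && Nat.ble (2 * t) (p * (2 * n + 1 - p))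

/-- Backtracking search for a colouring with prescribed sizes and sums. -/
def searchColouring : ℕ → (a b c d x y z w : ℕ) → Bool
  | 0, a, b, c, d, x, y, z, w => Nat.beq (a + b + c + d + x + y + z + w) 0
  | n + 1, a, b, c, d, x, y, z, w =>
    sumInRange (n + 1) a x && sumInRange (n + 1) b y && sumInRange (n + 1) c z &&
    sumInRange (n + 1) d w &&
    (Nat.ble 1 d && Nat.ble (n + 1) w &&
        searchColouring n a b c (d - 1) x y z (w - (n + 1)) ||
      Nat.ble 1 c && Nat.ble (n + 1) z &&
        searchColouring n a b (c - 1) d x y (z - (n + 1)) w ||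
      Nat.ble 1 b && Nat.ble (n + 1) y &&
        searchColouring n a (b - 1) c d x (y - (n + 1)) z w ||
      Nat.ble 1 a && Nat.ble (n + 1) x &&
        searchColouring n (a - 1) b c d (x - (n + 1)) y z w)

theorem FeasibleSums.of_searchColouring {n a b c d x y z w : ℕ}
    (h : searchColouring n a b c d x y z w = true) :
    FeasibleSums n ![(a : ℤ), b, c, d] ![(x : ℤ), y, z, w] := by
  induction n generalizing a b c d x y z w with
  | zero =>
    have h0 : a + b + c + d + x + y + z + w = 0 := Nat.eq_of_beq_eq_true h
    have : a = 0 ∧ b = 0 ∧ c = 0 ∧ d = 0 ∧ x = 0 ∧ y = 0 ∧ z = 0 ∧ w = 0 := by omega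
    obtain ⟨rfl, rfl, rfl, rfl, rfl, rfl, rfl, rfl⟩ := this
    exact ⟨fun _ => 0, fun i => by fin_cases i <;> simp⟩
  | succ n ih =>
    simp only [searchColouring, Bool.and_eq_true, Bool.or_eq_true, Nat.ble_eq] at h
    rcases h.2 with ((⟨⟨h1, h2⟩, h3⟩ | ⟨⟨h1, h2⟩, h3⟩) | ⟨⟨h1, h2⟩, h3⟩) | ⟨⟨h1, h2⟩, h3⟩
    · refine FeasibleSums.of_erase_max (i := 3) ?_
      convert ih h3 using 1 <;> funext k <;> fin_cases k <;>
        simp [Nat.cast_sub h1, Nat.cast_sub h2]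
    · refine FeasibleSums.of_erase_max (i := 2) ?_
      convert ih h3 using 1 <;> funext k <;> fin_cases k <;>
        simp [Nat.cast_sub h1, Nat.cast_sub h2]
    · refine FeasibleSums.of_erase_max (i := 1) ?_
      convert ih h3 using 1 <;> funext k <;> fin_cases k <;>
        simp [Nat.cast_sub h1, Nat.cast_sub h2]
    · refine FeasibleSums.of_erase_max (i := 0) ?_
      convert ih h3 using 1 <;> funext k <;> fin_cases k <;>
        simp [Nat.cast_sub h1, Nat.cast_sub h2]

theorem searchColouring_three : ∀ x ∈ List.range 20, ∀ y ∈ List.range 27, ∀ z ∈ List.range 34,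
    x ≤ y → y ≤ z → x + y + 2 * z ≤ 78 → 6 ≤ x → 21 ≤ x + y → 45 ≤ x + y + z →
      searchColouring 12 3 3 3 3 x y z (78 - (x + y + z)) = true := by
  decide +kernel

theorem searchColouring_two : ∀ y ∈ List.range 8, ∀ z ∈ List.range 11,
    y ≤ z → y + 2 * z ≤ 21 → 3 ≤ y → 10 ≤ y + z →
      searchColouring 6 0 2 2 2 0 y z (21 - (y + z)) = true := by
  decide +kernel

namespace Admissible

variable {n : ℕ} {p t : Fin 4 → ℤ}

theorem target_nonneg (h : Admissible n p t) (i : Fin 4) : p i * (p i + 1) ≤ 2 * t i := by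
  have h2 := two_mul_slack n p (fun i => (n + 1) * p i - t i) {i}
  have h3 := h.reflect.slack_nonneg {i}
  simp only [sum_singleton] at h2
  linarith

theorem feasible_of_forall_eq_three (h : Admissible n p t) (hp : ∀ i, p i = 3) :
    FeasibleSums n p t := by
  apply FeasibleSums.comp_equiv (Tuple.sort t)
  have hm := Tuple.monotone_sort t
  have h' := h.comp_equiv (Tuple.sort t)
  have hp' : ∀ i, (p ∘ Tuple.sort t) i = 3 := fun i => hp _
  generalize p ∘ Tuple.sort t = q at h' hp'
  generalize t ∘ Tuple.sort t = u at h' hm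
  obtain rfl : q = ![3, 3, 3, 3] := by
    funext i; rw [hp' i]; fin_cases i <;> rfl
  have hn := h'.sum_sizes
  simp [Fin.sum_univ_four] at hn
  obtain rfl : n = 12 := by omega
  have ht := h'.sum_targets
  rw [Fin.sum_univ_four] at ht
  have h0 := h'.target_nonneg 0
  have h01 := h'.slack_nonneg {2, 3}
  have h02 := h'.slack_nonneg {3}
  have m1 : u 0 ≤ u 1 := hm (by decide)
  have m2 : u 1 ≤ u 2 := hm (by decide)
  have m3 : u 2 ≤ u 3 := hm (by decide)
  simp [slack] at h0 h01 h02 ht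
  have hu : u = ![u 0, u 1, u 2, u 3] := by funext i; fin_cases i <;> rfl
  obtain ⟨x, hx⟩ := Int.eq_ofNat_of_zero_le (show 0 ≤ u 0 by omega)
  obtain ⟨y, hy⟩ := Int.eq_ofNat_of_zero_le (show 0 ≤ u 1 by omega)
  obtain ⟨z, hz⟩ := Int.eq_ofNat_of_zero_le (show 0 ≤ u 2 by omega)
  have := FeasibleSums.of_searchColouring (searchColouring_three x (List.mem_range.2 (by omega)) y
    (List.mem_range.2 (by omega)) z (List.mem_range.2 (by omega)) (by omega) (by omega) (by omega)
    (by omega) (by omega) (by omega))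
  have hw : u 3 = ((78 - (x + y + z) : ℕ) : ℤ) := by omega
  rw [hu, hx, hy, hz, hw]
  exact_mod_cast this

/-- Three parts of size two. -/
theorem feasible_of_two (h : Admissible n p t) {l : Fin 4} (hl : p l = 0)
    (hp : ∀ i, i ≠ l → p i = 2) : FeasibleSums n p t := by
  have hpos (i : Fin 4) (hi : i ≠ l) : 3 ≤ t i := by
    have := h.target_nonneg i
    rw [hp i hi] at this
    linarith
  have htl := h.target_eq_zero hl
  apply FeasibleSums.comp_equiv (Tuple.sort t)
  have hm := Tuple.monotone_sort t
  have h' := h.comp_equiv (Tuple.sort t)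
  have hl0 : Tuple.sort t 0 = l := by
    by_contra hne
    have h1 := hpos _ hne
    have h2 : (t ∘ Tuple.sort t) 0 ≤ (t ∘ Tuple.sort t) ((Tuple.sort t).symm l) :=
      hm (Fin.zero_le _)
    simp [htl] at h2
    linarith
  have hp' : ∀ i, (p ∘ Tuple.sort t) i = if i = 0 then 0 else 2 := fun i => by
    split_ifs with hi
    · rw [hi, Function.comp, hl0, hl]
    · exact hp _ fun hh => hi ((Tuple.sort t).injective (hh.trans hl0.symm))
  generalize p ∘ Tuple.sort t = q at h' hp'
  generalize t ∘ Tuple.sort t = u at h' hm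
  obtain rfl : q = ![0, 2, 2, 2] := by
    funext i; rw [hp' i]; fin_cases i <;> rfl
  have hn := h'.sum_sizes
  simp [Fin.sum_univ_four] at hn
  obtain rfl : n = 6 := by omega
  have ht := h'.sum_targets
  rw [Fin.sum_univ_four] at ht
  have hu0 : u 0 = 0 := h'.target_eq_zero (i := 0) rfl
  have h0 := h'.target_nonneg 1
  have h02 := h'.slack_nonneg {3}
  have m2 : u 1 ≤ u 2 := hm (by decide)
  have m3 : u 2 ≤ u 3 := hm (by decide)
  simp [slack] at h0 h02 ht
  have hu : u = ![u 0, u 1, u 2, u 3] := by funext i; fin_cases i <;> rfl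
  obtain ⟨y, hy⟩ := Int.eq_ofNat_of_zero_le (show 0 ≤ u 1 by omega)
  obtain ⟨z, hz⟩ := Int.eq_ofNat_of_zero_le (show 0 ≤ u 2 by omega)
  have := FeasibleSums.of_searchColouring (searchColouring_two y
    (List.mem_range.2 (by omega)) z (List.mem_range.2 (by omega)) (by omega) (by omega) (by omega)
    (by omega))
  have hw : u 3 = ((21 - (y + z) : ℕ) : ℤ) := by omega
  rw [hu, hu0, hy, hz, hw]
  exact_mod_cast this

end Admissible

namespace Admissible

variable {n : ℕ} {p t : Fin 4 → ℤ}

/-- Induction scheme: as long as some part has more than `m` elements, either the largest or the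
smallest element can be removed, unless a small part is nearly tight. -/
theorem feasible_of_reduction {Q : (Fin 4 → ℤ) → Prop} {m : ℤ} (hm : 1 ≤ m)
    (hdec : ∀ p i, Q p → m < p i → Q fun k => p k - if k = i then 1 else 0)
    (hsmall : ∀ n p t, Admissible n p t → Q p → (∀ i, p i ≤ m) → FeasibleSums n p t)
    (htight : ∀ n p t i, Admissible n p t → Q p → (∃ k, m < p k) → slack n p t {i} < p i →
      p i ≤ m → FeasibleSums n p t)
    (h : Admissible n p t) (hQ : Q p) : FeasibleSums n p t := by
  induction n generalizing p t with
  | zero =>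
    refine hsmall 0 p t h hQ fun i => ?_
    have h1 := single_le_sum (f := p) (fun k _ => h.nonneg k) (mem_univ i)
    rw [h.sum_sizes] at h1
    push_cast at h1
    linarith
  | succ n ih =>
    have step {t : Fin 4 → ℤ} (h : Admissible (n + 1) p t) {i : Fin 4} (hi : m < p i)
        (hJ : ∀ J, i ∉ J → ∑ k ∈ J, p k ≤ slack (n + 1) p t J) : FeasibleSums (n + 1) p t :=
      FeasibleSums.of_erase_max (ih (h.erase_max (by linarith) hJ) (hdec p i hQ hi))
    by_cases hall : ∀ i, p i ≤ m
    · exact hsmall _ p t h hQ hall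
    push Not at hall
    have top {t : Fin 4 → ℤ} (h : Admissible (n + 1) p t) {i : Fin 4}
        (hi : slack (n + 1) p t {i} < p i) : FeasibleSums (n + 1) p t := by
      rcases le_or_gt (p i) m with hle | hlt
      · exact htight _ p t i h hQ hall hi hle
      · exact step h hlt fun J hJ => h.sum_le_slack_of_singleton hi hJ
    by_cases h1 : ∃ i, slack (n + 1) p t {i} < p i
    · obtain ⟨i, hi⟩ := h1
      exact top h hi
    by_cases h2 : ∃ i, slack (n + 1) p t {i}ᶜ < p i
    · obtain ⟨i, hi⟩ := h2
      rw [← h.slack_reflect] at hi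
      exact (top h.reflect hi).reflect
    push Not at h1 h2
    obtain ⟨i, hi⟩ := hall
    rcases h.sum_le_slack_or h1 h2 (i := i) (by linarith) with h3 | h3
    · exact step h hi h3
    · refine (step h.reflect hi fun J hJ => ?_).reflect
      rw [h.slack_reflect]
      exact h3 J hJ

theorem slack_erase (h : Admissible n p t) {z : Fin 4} (hz : p z = 0) (J : Finset (Fin 4)) :
    slack n p t (J.erase z) = slack n p t J := by
  simp only [slack, Finset.sum_erase J hz, Finset.sum_erase J (h.target_eq_zero hz)]

theorem feasible_of_two_parts (h : Admissible n p t) {a b : Fin 4} (hab : a ≠ b)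
    (hp : ∀ k, k ≠ a → k ≠ b → p k = 0) : FeasibleSums n p t := by
  induction n generalizing p t with
  | zero =>
    have hp0 (i : Fin 4) : p i = 0 := by
      have h1 := single_le_sum (f := p) (fun k _ => h.nonneg k) (mem_univ i)
      rw [h.sum_sizes] at h1
      push_cast at h1
      linarith [h.nonneg i]
    exact ⟨fun _ => a, fun i => by simp [hp0 i, h.target_eq_zero (hp0 i)]⟩
  | succ n ih =>
    have step {a b : Fin 4} (hp : ∀ k, k ≠ a → k ≠ b → p k = 0)
        (ih : Admissible n (fun k => p k - if k = a then 1 else 0)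
          (fun k => t k - if k = a then (n : ℤ) + 1 else 0) →
          FeasibleSums n (fun k => p k - if k = a then 1 else 0)
          (fun k => t k - if k = a then (n : ℤ) + 1 else 0))
        (ha : 1 ≤ p a) (hb : p b ≤ slack (n + 1) p t {b}) : FeasibleSums (n + 1) p t := by
      refine FeasibleSums.of_erase_max (ih (h.erase_max ha fun J hJ => ?_))
      by_cases hbJ : b ∈ J
      · have hz : ∀ k ∈ J, k ≠ b → p k = 0 := fun k hk hkb =>
          hp k (fun hka => hJ (hka ▸ hk)) hkb
        have e1 : ∑ k ∈ J, p k = p b := sum_eq_single_of_mem b hbJ hz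
        have e2 : ∑ k ∈ J, t k = t b :=
          sum_eq_single_of_mem b hbJ fun k hk hkb => h.target_eq_zero (hz k hk hkb)
        simpa [slack, e1, e2] using hb
      · rw [Finset.sum_eq_zero fun k hk =>
          hp k (fun hka => hJ (hka ▸ hk)) fun hkb => hbJ (hkb ▸ hk)]
        exact h.slack_nonneg J
    have hsub (c : Fin 4) (hc : c = a ∨ c = b) (k : Fin 4) (hka : k ≠ a) (hkb : k ≠ b) :
        (p k - if k = c then 1 else 0) = 0 := by
      rw [hp k hka hkb, if_neg (by rcases hc with rfl | rfl <;> assumption), sub_zero]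
    have ha := h.nonneg a
    have hb := h.nonneg b
    have hsa := h.slack_nonneg {a}
    have hsb := h.slack_nonneg {b}
    by_cases h1 : 1 ≤ p a ∧ p b ≤ slack (n + 1) p t {b}
    · exact step hp (fun h' => ih h' (hsub a (.inl rfl))) h1.1 h1.2
    by_cases h2 : 1 ≤ p b ∧ p a ≤ slack (n + 1) p t {a}
    · exact step (fun k hk hk' => hp k hk' hk) (fun h' => ih h' (hsub b (.inr rfl))) h2.1 h2.2
    exfalso
    have hsum : p a + p b = n + 1 := by
      have := h.sum_sizes
      rw [← sum_subset (subset_univ {a, b}) fun k _ hk => hp k (by aesop) (by aesop),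
        sum_pair hab] at this
      exact_mod_cast this
    by_cases hlt : slack (n + 1) p t {a} < p a
    · have h3 := h.sum_le_slack_of_singleton hlt (J := {b}) (by simpa using hab)
      rw [sum_singleton] at h3
      have : ¬ 1 ≤ p a := fun h' => h1 ⟨h', h3⟩
      linarith [hlt, show p a = 0 by omega]
    · have : ¬ 1 ≤ p b := fun h' => h2 ⟨h', not_lt.1 hlt⟩
      exact h1 ⟨by omega, by omega⟩

/-- Three parts, each of size at least two. -/
theorem feasible_of_three_parts (h : Admissible n p t)
    (hp : ∃ z, p z = 0 ∧ ∀ k, k ≠ z → 2 ≤ p k) : FeasibleSums n p t := by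
  refine feasible_of_reduction (m := 2) (Q := fun p => ∃ z, p z = 0 ∧ ∀ k, k ≠ z → 2 ≤ p k)
    (by norm_num) ?_ ?_ ?_ h hp
  · rintro p i ⟨z, hz, hp⟩ hi
    have hzi : z ≠ i := by rintro rfl; linarith
    refine ⟨z, by simp [hz, hzi], fun k hk => ?_⟩
    have := hp k hk
    dsimp only
    split_ifs with hki
    · subst hki; linarith
    · linarith
  · rintro n p t h ⟨z, hz, hp⟩ hall
    exact h.feasible_of_two hz fun i hi => le_antisymm (hall i) (hp i hi)
  · rintro n p t i h ⟨z, hz, hp⟩ - hlt hle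
    have hs0 := h.slack_nonneg {i}
    have hiz : i ≠ z := by rintro rfl; linarith
    have hpi : p i = (2 : ℕ) := le_antisymm hle (hp i hiz)
    obtain ⟨s, hs⟩ := Int.eq_ofNat_of_zero_le hs0
    obtain ⟨a, b, hab, hai, haz, hbi, hbz, hcov⟩ : ∃ a b : Fin 4, a ≠ b ∧ a ≠ i ∧ a ≠ z ∧ b ≠ i ∧
        b ≠ z ∧ ∀ x, x = i ∨ x = z ∨ x = a ∨ x = b := by
      clear * - hiz; revert i z; decide
    have hpa := hp a haz
    have hpb := hp b hbz
    have hn := h.sum_sizes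
    have hn2 : p i + p a + p b ≤ n := by
      rw [← hn, ← sum_subset (subset_univ {i, a, b}) fun k _ hk => ?_]
      · rw [sum_insert (by simp [hai.symm, hbi.symm]), sum_pair hab]; linarith
      · rcases hcov k with rfl | rfl | rfl | rfl <;> simp_all
    obtain ⟨N, rfl⟩ : ∃ N, n = N + (2 + 1) := ⟨n - 3, by push_cast at hpi; omega⟩
    have finish (a b : Fin 4) (hai : a ≠ i) (haz : a ≠ z) (hbi : b ≠ i) (hbz : b ≠ z)
        (hcov : ∀ x, x = i ∨ x = z ∨ x = a ∨ x = b)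
        (hK : p b + s ≤ slack (N + (2 + 1)) p t {i, b}) : FeasibleSums (N + (2 + 1)) p t := by
      have hab : a ≠ b := by rintro rfl; clear * - hcov; revert i z a; decide
      have hpa := hp a haz
      refine FeasibleSums.of_erase_block hai.symm hpi (by omega) hs
        (feasible_of_two_parts (h.erase_block hai.symm hpi (by linarith) hs fun K hiK haK => ?_)
          hab fun k hka hkb => ?_)
      · rw [← h.slack_erase hz, erase_insert_of_ne hiz, ← Finset.sum_erase K hz]
        by_cases hbK : b ∈ K
        · have : K.erase z = {b} := by
            ext x; have := hcov x; simp; grind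
          rw [this, sum_singleton]
          exact hK
        · have : K.erase z = ∅ := by
            ext x; have := hcov x; simp; grind
          rw [this, sum_empty, insert_empty_eq, hs]
          simp
      · rcases hcov k with rfl | rfl | rfl | rfl
        · simp
        · simp [hz, haz.symm]
        · exact absurd rfl hka
        · exact absurd rfl hkb
    by_cases h1 : p b + s ≤ slack (N + (2 + 1)) p t {i, b}
    · exact finish a b hai haz hbi hbz hcov h1
    by_cases h2 : p a + s ≤ slack (N + (2 + 1)) p t {i, a}
    · exact finish b a hbi hbz hai haz (fun x => by have := hcov x; tauto) h2
    exfalso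
    have h3 := slack_add_slack (N + (2 + 1)) p t {i, a} {i, b}
    have e1 : ({i, a} : Finset (Fin 4)) ∩ {i, b} = {i} := by
      ext x; simp; grind
    have e2 : ({i, a} : Finset (Fin 4)) \ {i, b} = {a} := by
      ext x; simp; grind
    have e3 : ({i, b} : Finset (Fin 4)) \ {i, a} = {b} := by
      ext x; simp; grind
    rw [e1, e2, e3, sum_singleton, sum_singleton, hs] at h3
    have h4 := h.slack_nonneg ({i, a} ∪ {i, b})
    push Not at h1 h2
    push_cast at hpi
    nlinarith

/-- Arithmetic behind the choice of the part that receives the remaining large element. -/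
theorem exists_recipient {A B C s xa xb xc xab xbc xac : ℤ} (hA : 3 ≤ A) (hB : 3 ≤ B) (hC : 3 ≤ C)
    (hl : 4 ≤ A ∨ 4 ≤ B ∨ 4 ≤ C) (hs : s ≤ 2)
    (nab : 0 ≤ xab) (nbc : 0 ≤ xbc) (nac : 0 ≤ xac)
    (hab : xa + xb = s + xab + A * B) (hbc : xb + xc = s + xbc + B * C)
    (hca : xc + xa = s + xac + C * A)
    (ha : xa + xbc = s + A * (B + C)) (hb : xb + xac = s + B * (C + A))
    (hc : xc + xab = s + C * (A + B)) :
    (B + s ≤ xb ∧ C + s ≤ xc ∧ B + C + s ≤ xbc) ∨ (C + s ≤ xc ∧ A + s ≤ xa ∧ C + A + s ≤ xac) ∨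
      (A + s ≤ xa ∧ B + s ≤ xb ∧ A + B + s ≤ xab) := by
  have mAB : 4 ≤ (A - 1) * (B - 1) := by nlinarith
  have mBC : 4 ≤ (B - 1) * (C - 1) := by nlinarith
  have mCA : 4 ≤ (C - 1) * (A - 1) := by nlinarith
  by_cases ga : xa < A + s
  · exact .inl ⟨by linarith, by linarith, by linarith⟩
  by_cases gb : xb < B + s
  · exact .inr (.inl ⟨by linarith, by linarith, by linarith⟩)
  by_cases gc : xc < C + s
  · exact .inr (.inr ⟨by linarith, by linarith, by linarith⟩)
  push Not at ga gb gc
  by_contra! hcon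
  have bbc := hcon.1 gb gc
  have bca := hcon.2.1 gc ga
  have bab := hcon.2.2 ga gb
  have k1 : (B - 1) * (C - 1) ≤ A + 1 := by linarith
  have k2 : (C - 1) * (A - 1) ≤ B + 1 := by linarith
  have k3 : (A - 1) * (B - 1) ≤ C + 1 := by linarith
  rcases hl with h | h | h
  · have h1 : 3 * (C - 1) ≤ (C - 1) * (A - 1) := by nlinarith
    have h2 : 3 * (B - 1) ≤ (A - 1) * (B - 1) := by nlinarith
    linarith
  · have h1 : 3 * (C - 1) ≤ (B - 1) * (C - 1) := by nlinarith
    have h2 : 3 * (A - 1) ≤ (A - 1) * (B - 1) := by nlinarith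
    linarith
  · have h1 : 3 * (A - 1) ≤ (C - 1) * (A - 1) := by nlinarith
    have h2 : 3 * (B - 1) ≤ (B - 1) * (C - 1) := by nlinarith
    linarith

theorem slack_add_slack_of_univ (h : Admissible n p t) {i a b c : Fin 4} (hab : a ≠ b)
    (hac : a ≠ c) (hbc : b ≠ c) (hai : a ≠ i) (hbi : b ≠ i) (hci : c ≠ i)
    (hcov : ∀ x, x = i ∨ x = a ∨ x = b ∨ x = c) :
    slack n p t {i, a} + slack n p t {i, b} =
        slack n p t {i} + slack n p t {i, a, b} + p a * p b ∧
      slack n p t {i, a} + slack n p t {i, b, c} = slack n p t {i} + p a * (p b + p c) := by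
  constructor
  · rw [slack_add_slack]
    have e1 : ({i, a} : Finset (Fin 4)) ∩ {i, b} = {i} := by ext x; simp; grind
    have e2 : ({i, a} : Finset (Fin 4)) \ {i, b} = {a} := by ext x; simp; grind
    have e3 : ({i, b} : Finset (Fin 4)) \ {i, a} = {b} := by ext x; simp; grind
    have e4 : ({i, a} : Finset (Fin 4)) ∪ {i, b} = {i, a, b} := by ext x; simp
    rw [e1, e2, e3, e4, sum_singleton, sum_singleton]
  · rw [slack_add_slack]
    have e1 : ({i, a} : Finset (Fin 4)) ∩ {i, b, c} = {i} := by ext x; simp; grind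
    have e2 : ({i, a} : Finset (Fin 4)) \ {i, b, c} = {a} := by ext x; simp; grind
    have e3 : ({i, b, c} : Finset (Fin 4)) \ {i, a} = {b, c} := by ext x; simp; grind
    have e4 : ({i, a} : Finset (Fin 4)) ∪ {i, b, c} = univ := by
      ext x; have := hcov x; simp; grind
    rw [e1, e2, e3, e4, sum_singleton, sum_pair hbc, h.slack_univ, add_zero]

theorem feasible_of_tight_three {N s : ℕ} (h : Admissible (N + (3 + 1)) p t) (hp : ∀ i, 3 ≤ p i)
    {i : Fin 4} (hpi : p i = (3 : ℕ)) (hs : slack (N + (3 + 1)) p t {i} = s) (hlt : s < 3)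
    {a b c : Fin 4} (hbc : b ≠ c) (hai : a ≠ i) (hcov : ∀ x, x = i ∨ x = a ∨ x = b ∨ x = c)
    (hb : p b + s ≤ slack (N + (3 + 1)) p t {i, b})
    (hc : p c + s ≤ slack (N + (3 + 1)) p t {i, c})
    (hbc' : p b + p c + s ≤ slack (N + (3 + 1)) p t {i, b, c}) :
    FeasibleSums (N + (3 + 1)) p t := by
  have hpa := hp a
  refine FeasibleSums.of_erase_block hai.symm hpi (by push_cast at hpi; omega) hs
    (feasible_of_three_parts
      (h.erase_block hai.symm hpi (by linarith) hs fun K hiK haK => ?_)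
      ⟨i, by simp, fun k hk => ?_⟩)
  · by_cases hbK : b ∈ K <;> by_cases hcK : c ∈ K
    · have : K = {b, c} := by
        ext x; have := hcov x; simp; grind
      rw [this, sum_pair hbc]
      exact hbc'
    · have : K = {b} := by
        ext x; have := hcov x; simp; grind
      rw [this, sum_singleton]
      exact hb
    · have : K = {c} := by
        ext x; have := hcov x; simp; grind
      rw [this, sum_singleton]
      exact hc
    · have : K = ∅ := by
        ext x; have := hcov x; simp; grind
      rw [this, sum_empty, insert_empty_eq, hs]
      simp
  · have := hp k
    simp only [if_neg hk]
    split_ifs <;> linarith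

/-- Four parts, each of size at least three. -/
theorem feasible_of_three_le (h : Admissible n p t) (hp : ∀ i, 3 ≤ p i) :
    FeasibleSums n p t := by
  refine feasible_of_reduction (m := 3) (Q := fun p => ∀ i, 3 ≤ p i)
    (by norm_num) ?_ ?_ ?_ h hp
  · intro p i hp hi k
    have := hp k
    dsimp only
    split_ifs with hki
    · subst hki; linarith
    · linarith
  · intro n p t h hp hall
    exact h.feasible_of_forall_eq_three fun i => le_antisymm (hall i) (hp i)
  · rintro n p t i h hp ⟨l, hl⟩ hlt hle
    have hs0 := h.slack_nonneg {i}
    have hpi : p i = (3 : ℕ) := le_antisymm hle (hp i)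
    obtain ⟨s, hs⟩ := Int.eq_ofNat_of_zero_le hs0
    obtain ⟨a, b, c, hab, hac, hbc, hai, hbi, hci, hcov⟩ : ∃ a b c : Fin 4, a ≠ b ∧ a ≠ c ∧ b ≠ c ∧
        a ≠ i ∧ b ≠ i ∧ c ≠ i ∧ ∀ x, x = i ∨ x = a ∨ x = b ∨ x = c := by
      clear * -; revert i; decide
    have hpa := hp a
    have hpb := hp b
    have hpc := hp c
    have hn2 : p i + p a ≤ n := by
      rw [← h.sum_sizes, ← sum_pair hai.symm]
      exact sum_le_sum_of_subset_of_nonneg (subset_univ _) fun k _ _ => h.nonneg k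
    obtain ⟨N, rfl⟩ : ∃ N, n = N + (3 + 1) := ⟨n - 4, by push_cast at hpi; omega⟩
    have hcov₂ (x : Fin 4) : x = i ∨ x = b ∨ x = c ∨ x = a := by
      have := hcov x; clear * - this; tauto
    have hcov₃ (x : Fin 4) : x = i ∨ x = c ∨ x = a ∨ x = b := by
      have := hcov x; clear * - this; tauto
    obtain ⟨ab1, a_bc⟩ := h.slack_add_slack_of_univ hab hac hbc hai hbi hci hcov
    obtain ⟨bc1, b_ca⟩ := h.slack_add_slack_of_univ hbc hab.symm hac.symm hbi hci hai hcov₂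
    obtain ⟨ca1, c_ab⟩ := h.slack_add_slack_of_univ hac.symm hbc.symm hab hci hai hbi
      hcov₃
    have hlt' : s < 3 := by push_cast at hpi; omega
    have hfa := h.feasible_of_tight_three hp hpi hs hlt' (a := a) hbc hai hcov
    have hfb := h.feasible_of_tight_three hp hpi hs hlt' (a := b) hac.symm hbi hcov₂
    have hfc := h.feasible_of_tight_three hp hpi hs hlt' (a := c) hab hci hcov₃
    rw [hs] at ab1 a_bc bc1 b_ca ca1 c_ab
    rw [pair_comm c a] at ca1 b_ca hfb
    have nab := h.slack_nonneg {i, a, b}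
    have nbc := h.slack_nonneg {i, b, c}
    have nac := h.slack_nonneg {i, a, c}
    have hl' : 4 ≤ p a ∨ 4 ≤ p b ∨ 4 ≤ p c := by
      rcases hcov l with rfl | rfl | rfl | rfl
      · linarith
      all_goals omega
    push_cast at hpi
    rcases exists_recipient hpa hpb hpc hl' (by omega) nab nbc nac ab1 bc1 ca1
      a_bc b_ca c_ab with hh | hh | hh
    · exact hfa hh.1 hh.2.1 hh.2.2
    · exact hfb hh.1 hh.2.1 hh.2.2
    · exact hfc hh.1 hh.2.1 hh.2.2

end Admissible

theorem two_mul_sum_range_sub {n P : ℕ} (h : P ≤ n) :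
    2 * ((∑ i ∈ range P, (n - i) : ℕ) : ℤ) = P * (2 * n + 1 - P) := by
  induction P with
  | zero => simp
  | succ P ih =>
    rw [sum_range_succ]
    push_cast [Nat.cast_sub (show P ≤ n by omega)]
    have := ih (by omega)
    push_cast at this
    linarith

theorem sum_le_sum_range_sub {n : ℕ} {U : Finset ℕ} (hU : U ⊆ Icc 1 n) :
    U.sum id ≤ ∑ i ∈ range U.card, (n - i) := by
  induction n generalizing U with
  | zero => simp_all
  | succ n ih =>
    by_cases hmem : n + 1 ∈ U
    · have h1 : U.erase (n + 1) ⊆ Icc 1 n := fun x hx => by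
        have := hU (mem_of_mem_erase hx)
        have := ne_of_mem_erase hx
        simp only [mem_Icc] at *
        omega
      have h2 := ih h1
      rw [card_erase_of_mem hmem] at h2
      obtain ⟨m, hm⟩ : ∃ m, U.card = m + 1 :=
        ⟨U.card - 1, by have := card_pos.2 ⟨_, hmem⟩; omega⟩
      rw [hm, sum_range_succ', ← add_sum_erase U id hmem]
      simp only [hm, Nat.add_sub_cancel, Nat.add_sub_add_right] at h2 ⊢
      simp only [id]
      simp only [id] at h2
      omega
    · have h1 : U ⊆ Icc 1 n := fun x hx => by
        have := hU hx
        have : x ≠ n + 1 := fun h => hmem (h ▸ hx)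
        simp only [mem_Icc] at *
        omega
      exact (ih h1).trans (sum_le_sum fun i _ => by omega)

theorem StarCond.of_equitable {n k : ℕ} {A : Fin k → Finset ℕ} {p : Fin k → ℕ}
    (hA : Implements n A p) (hE : Equitable n A) : StarCond n k p := by
  obtain ⟨⟨hdisj, hcov⟩, e, he⟩ := hA
  intro j
  have hd : Set.PairwiseDisjoint (Iic j : Set (Fin k)) fun t => A (e t) :=
    fun x _ y _ hxy => hdisj _ _ (e.injective.ne hxy)
  have hsub : (Iic j).biUnion (fun t => A (e t)) ⊆ Icc 1 n := by
    rw [← hcov]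
    intro x hx
    obtain ⟨t, -, ht⟩ := mem_biUnion.1 hx
    exact mem_biUnion.2 ⟨e t, mem_univ _, ht⟩
  have h := sum_le_sum_range_sub hsub
  rw [card_biUnion (by simpa using hd), sum_biUnion (by simpa using hd),
    sum_congr rfl fun t _ => hE (e t), sum_congr rfl fun t _ => he t, sum_const,
    Fin.card_Iic, smul_eq_mul] at h
  exact h

theorem eight_mul_magicConst {n : ℕ} (hdvd : 4 ∣ n * (n + 1) / 2) :
    8 * magicConst n 4 = n * (n + 1) := by
  have h1 := Nat.mul_div_cancel' hdvd
  have h2 := Nat.mul_div_cancel' (Nat.even_mul_succ_self n).two_dvd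
  unfold magicConst
  omega

theorem StarCond.two_mul_le {n : ℕ} {p : Fin 4 → ℕ} (h : StarCond n 4 p)
    (hsum : ∑ i, p i = n) (j : Fin 4) :
    2 * (((j : ℕ) + 1) * (magicConst n 4 : ℤ)) ≤
      (∑ t ∈ Iic j, (p t : ℤ)) * (2 * n + 1 - ∑ t ∈ Iic j, (p t : ℤ)) := by
  have hle : ∑ t ∈ Iic j, p t ≤ n := hsum ▸ sum_le_sum_of_subset (subset_univ _)
  have h1 := two_mul_sum_range_sub hle
  have h2 : ((((j : ℕ) + 1) * magicConst n 4 : ℕ) : ℤ) ≤ _ := Int.ofNat_le.2 (h j)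
  push_cast at h1 h2 ⊢
  linarith

/-- The `j` smallest parts are the first ones. -/
theorem sum_Iic_le_sum {p : Fin 4 → ℕ} (hmono : Monotone p) {J : Finset (Fin 4)} {j : Fin 4}
    (hJ : J.card = j + 1) : ∑ t ∈ Iic j, p t ≤ ∑ t ∈ J, p t := by
  have h01 : p 0 ≤ p 1 := hmono (by decide)
  have h12 : p 1 ≤ p 2 := hmono (by decide)
  have h23 : p 2 ≤ p 3 := hmono (by decide)
  have key (K : Finset (Fin 4)) (f : Fin 4 → ℕ) :
      ∑ t ∈ K, f t = ∑ t, if t ∈ K then f t else 0 := by simp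
  rw [card_eq_sum_ones, key, Fin.sum_univ_four] at hJ
  rw [key, key J, Fin.sum_univ_four, Fin.sum_univ_four]
  simp only [mem_Iic]
  fin_cases j <;> simp at hJ ⊢ <;> split_ifs at hJ ⊢ <;> omega

theorem StarCond.admissible {n : ℕ} {p : Fin 4 → ℕ} (h : StarCond n 4 p)
    (hdvd : 4 ∣ n * (n + 1) / 2) (hmono : Monotone p) (hsum : ∑ i, p i = n) :
    Admissible n (fun i => (p i : ℤ)) (fun _ => (magicConst n 4 : ℤ)) where
  nonneg i := Int.natCast_nonneg _
  sum_sizes := by exact_mod_cast hsum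
  sum_targets := by
    have := eight_mul_magicConst hdvd
    simp only [sum_const, card_univ, Fintype.card_fin, nsmul_eq_mul]
    push_cast
    zify at this
    linarith
  slack_nonneg J := by
    have h1 := two_mul_slack n (fun i => (p i : ℤ)) (fun _ => (magicConst n 4 : ℤ)) J
    rw [sum_const, nsmul_eq_mul] at h1
    rcases J.eq_empty_or_nonempty with rfl | hne
    · simp [slack]
    have hc := card_le_univ J
    rw [Fintype.card_fin] at hc
    have hc0 := hne.card_pos
    have hJ : J.card = ((⟨J.card - 1, by omega⟩ : Fin 4) : ℕ) + 1 := by simp only; omega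
    generalize (⟨J.card - 1, by omega⟩ : Fin 4) = j at hJ
    have h2 := h.two_mul_le hsum j
    have h3 := sum_Iic_le_sum hmono hJ
    have h4 : ∑ t ∈ J, p t ≤ n := hsum ▸ sum_le_sum_of_subset (subset_univ _)
    rw [hJ] at h1
    zify at h3 h4
    push_cast at h1
    generalize ∑ t ∈ Iic j, (p t : ℤ) = P at *
    generalize ∑ t ∈ J, (p t : ℤ) = R at *
    nlinarith [mul_nonneg (sub_nonneg.2 h3) (show 0 ≤ 2 * (n : ℤ) + 1 - R - P by linarith)]

theorem FeasibleSums.exists_equitable {n : ℕ} {p : Fin 4 → ℕ}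
    (h : FeasibleSums n (fun i => (p i : ℤ)) (fun _ => (magicConst n 4 : ℤ))) :
    ∃ A : Fin 4 → Finset ℕ, Implements n A p ∧ Equitable n A := by
  obtain ⟨c, hc⟩ := h
  have hinj : Function.Injective (· + 1 : ℕ → ℕ) := add_left_injective 1
  refine ⟨fun i => ((range n).filter fun x => c x = i).image (· + 1),
    ⟨⟨fun i j hij => ?_, ?_⟩, Equiv.refl _, fun i => ?_⟩, fun i => ?_⟩
  · rw [disjoint_image hinj, disjoint_filter]
    rintro x - rfl hj
    exact hij hj
  · ext x
    simp only [mem_biUnion, mem_univ, true_and, mem_image, mem_filter, mem_range, mem_Icc]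
    constructor
    · rintro ⟨i, y, ⟨hy, -⟩, rfl⟩
      omega
    · rintro ⟨h1, h2⟩
      exact ⟨_, x - 1, ⟨by omega, rfl⟩, by omega⟩
  · rw [Equiv.refl_apply, card_image_of_injective _ hinj]
    have := (hc i).1
    dsimp only at this
    rw [sum_boole] at this
    exact_mod_cast this
  · rw [sum_image hinj.injOn]
    have := (hc i).2
    dsimp only at this
    rw [← sum_filter] at this
    simp only [id]
    exact_mod_cast this

theorem StarCond.eight_of_two {n : ℕ} {p : Fin 4 → ℕ} (h : StarCond n 4 p)
    (hdvd : 4 ∣ n * (n + 1) / 2) (hmono : Monotone p) (hsum : ∑ i, p i = n) (hp0 : p 0 = 2) :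
    n = 8 ∧ ∀ i, p i = 2 := by
  have hle (i : Fin 4) : 2 ≤ p i := hp0 ▸ hmono (Fin.zero_le i)
  rw [Fin.sum_univ_four] at hsum
  have h8 := eight_mul_magicConst hdvd
  have h0 := h 0
  have h1 := hle 1
  have h2 := hle 2
  have h3 := hle 3
  have hI : Iic (0 : Fin 4) = {0} := by decide
  rw [hI, sum_singleton, hp0] at h0
  simp [sum_range_succ] at h0
  have hn : n ≤ 14 := by
    by_contra! hn
    have : magicConst n 4 + 1 ≤ 2 * n := by omega
    nlinarith
  have : n = 8 := by
    have : 8 ≤ n := by omega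
    clear * - this hn hdvd
    interval_cases n <;> first | rfl | omega
  refine ⟨this, fun i => ?_⟩
  fin_cases i <;> simp <;> omega

theorem exists_equitable_eight {p : Fin 4 → ℕ} (hp : ∀ i, p i = 2) :
    ∃ A : Fin 4 → Finset ℕ, Implements 8 A p ∧ Equitable 8 A := by
  refine ⟨![{1, 8}, {2, 7}, {3, 6}, {4, 5}], ⟨⟨by decide, by decide⟩, Equiv.refl _, ?_⟩, ?_⟩
  · simp only [hp]
    decide
  · unfold Equitable
    decide

/-- Conjecture 1 holds for `k = 4`. -/
theorem stmt_1 (n : ℕ) (hn : 0 < n) (hdvd : 4 ∣ n * (n + 1) / 2)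
    (p : Fin 4 → ℕ) (hp1 : 1 < p 0) (hmono : Monotone p)
    (hsum : ∑ i : Fin 4, p i = n) :
    (∃ A : Fin 4 → Finset ℕ, Implements n A p ∧ Equitable n A) ↔ StarCond n 4 p := by
  refine ⟨fun ⟨A, hA, hE⟩ => .of_equitable hA hE, fun h => ?_⟩
  by_cases hp0 : p 0 = 2
  · obtain ⟨rfl, hp⟩ := h.eight_of_two hdvd hmono hsum hp0
    exact exists_equitable_eight hp
  · refine ((h.admissible hdvd hmono hsum).feasible_of_three_le fun i => ?_).exists_equitable
    have := hmono (Fin.zero_le i)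
    omega
end

section
/- Let n and k be positive integers with k < n and k dividing n(n+1)/2, and let p_1 ≤ p_2 ≤ … ≤ p_k be positive integers with p_1 = 1 and p_1+…+p_k = n. If there exists an equitable partition of [n] implementing (p_1,…,p_k), then n = s^{n,k} (equivalently n + 1 = 2k), the unique set of size 1 in the partition is {n}, and p_i = 2 for all i = 2,…,k. -/
open Finset

/-- the case `p₁ = 1`. -/
theorem stmt_4 (n k : ℕ) (hn : 0 < n) (hk : 0 < k) (hkn : k < n)
    (hdvd : k ∣ n * (n + 1) / 2)
    (p : Fin k → ℕ) (hp : ∀ i, 0 < p i) (hmono : Monotone p)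
    (hp1 : p ⟨0, hk⟩ = 1) (hsum : ∑ i : Fin k, p i = n)
    (A : Fin k → Finset ℕ) (hA : Implements n A p) (heq : Equitable n A) :
    n = magicConst n k ∧ n + 1 = 2 * k ∧
      (∃! i : Fin k, (A i).card = 1) ∧
      (∀ i : Fin k, (A i).card = 1 → A i = {n}) ∧
      (∀ i : Fin k, i ≠ ⟨0, hk⟩ → p i = 2) := by
  obtain ⟨⟨hdisj, hunion⟩, e, he⟩ := hA
  have hmem (i : Fin k) (x : ℕ) (hx : x ∈ A i) : 1 ≤ x ∧ x ≤ n := by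
    rw [← Finset.mem_Icc, ← hunion]
    exact Finset.mem_biUnion.2 ⟨i, Finset.mem_univ i, hx⟩
  have hsingle (i : Fin k) (hi : (A i).card = 1) : A i = {magicConst n k} := by
    obtain ⟨x, hx⟩ := Finset.card_eq_one.1 hi
    have hsumx := heq i
    rw [hx, Finset.sum_singleton, id] at hsumx
    rw [hx, hsumx]
  have hcard : (A (e ⟨0, hk⟩)).card = 1 := by rw [he, hp1]
  have hle : magicConst n k ≤ n := by
    refine (hmem (e ⟨0, hk⟩) _ ?_).2
    rw [hsingle _ hcard]
    exact Finset.mem_singleton_self _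
  have hge : n ≤ magicConst n k := by
    have hnmem : n ∈ Finset.univ.biUnion A := by
      rw [hunion]
      exact Finset.mem_Icc.2 ⟨hn, le_rfl⟩
    obtain ⟨j, -, hj⟩ := Finset.mem_biUnion.1 hnmem
    rw [← heq j]
    exact Finset.single_le_sum (f := id) (fun _ _ => Nat.zero_le _) hj
  have hs : n = magicConst n k := le_antisymm hge hle
  have hnk : n + 1 = 2 * k := by
    have hmul : k * n = n * (n + 1) / 2 := by
      conv_lhs => rw [hs]
      exact Nat.mul_div_cancel' hdvd
    have htwo : 2 * (n * (n + 1) / 2) = n * (n + 1) :=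
      Nat.mul_div_cancel' (Nat.even_mul_succ_self n).two_dvd
    rw [← hmul] at htwo
    exact Nat.eq_of_mul_eq_mul_left hn (by linarith)
  have huniq (i j : Fin k) (hi : (A i).card = 1) (hj : (A j).card = 1) : i = j := by
    by_contra hij
    have hd := hdisj i j hij
    rw [hsingle i hi, hsingle j hj] at hd
    simp at hd
  refine ⟨hs, hnk, ⟨e ⟨0, hk⟩, hcard, fun j hj => huniq j _ hj hcard⟩, fun i hi => ?_, ?_⟩
  · rw [hsingle i hi, ← hs]
  · have htwo_le : ∀ i ∈ Finset.univ.erase (⟨0, hk⟩ : Fin k), 2 ≤ p i := by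
      intro i hi
      have hne : p i ≠ 1 := fun h =>
        Finset.ne_of_mem_erase hi (e.injective (huniq _ _ (by rw [he, h]) hcard))
      have := hp i
      omega
    have hrest := Finset.add_sum_erase Finset.univ p (Finset.mem_univ (⟨0, hk⟩ : Fin k))
    have hconst : ∑ _i ∈ Finset.univ.erase (⟨0, hk⟩ : Fin k), 2 = (k - 1) * 2 := by
      simp
    intro i hi
    refine ((Finset.sum_eq_sum_iff_of_le htwo_le).1 ?_ i
      (Finset.mem_erase.2 ⟨hi, Finset.mem_univ i⟩)).symm
    omega
end

section
/- Let {A_1,…,A_k} be a partition of [n] with k dividing n(n+1)/2, let i ≠ j, let a ∈ A_i and b ∈ A_j with a < b, and let A' be the partition obtained by replacing A_i with (A_i ∖ {a}) ∪ {b} and A_j with (A_j ∖ {b}) ∪ {a}. Then d(A') = d(A) + 2(b−a)·((b−a) − (S(A_j) − S(A_i))). In particular, d(A') = d(A) if b − a = S(A_j) − S(A_i), d(A') > d(A) if b − a > S(A_j) − S(A_i), and d(A') < d(A) if b − a < S(A_j) − S(A_i). -/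
open Finset

lemma sum_insert_erase_cast {s : Finset ℕ} {x y : ℕ} (hx : x ∈ s) (hy : y ∉ s) :
    (((insert y (s.erase x)).sum id : ℕ) : ℤ) = ((s.sum id : ℕ) : ℤ) + y - x := by
  have h := Finset.add_sum_erase s id hx
  rw [Finset.sum_insert (fun h => hy (Finset.mem_of_mem_erase h)), ← h]
  push_cast [id]
  ring

lemma sum_sub_sum_of_eq_off_pair {ι : Type*} [Fintype ι] {i j : ι} (hij : i ≠ j) (f g : ι → ℤ)
    (h : ∀ l, l ≠ i → l ≠ j → f l = g l) :
    ∑ l, f l - ∑ l, g l = (f i - g i) + (f j - g j) := by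
  rw [← Finset.sum_sub_distrib]
  exact Fintype.sum_eq_add i j hij fun l hl => sub_eq_zero.2 (h l hl.1 hl.2)

/-- the effect of the exchange operator `χ_{a,b}` on `d`
(Observation 1). Here `A'` is the partition obtained from `A` by exchanging
`a` and `b` between the parts `A i` and `A j`. -/
theorem stmt_6 (n k : ℕ) (hn : 0 < n) (hk : 0 < k) (hdvd : k ∣ n * (n + 1) / 2)
    (A : Fin k → Finset ℕ) (hA : IsPartitionOn n A)
    (i j : Fin k) (hij : i ≠ j) (a b : ℕ) (ha : a ∈ A i) (hb : b ∈ A j) (hab : a < b)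
    (A' : Fin k → Finset ℕ)
    (hA' : A' = Function.update (Function.update A i (insert b ((A i).erase a))) j
      (insert a ((A j).erase b)))
    (t u : ℤ) (ht : t = (b : ℤ) - (a : ℤ))
    (hu : u = (((A j).sum id : ℕ) : ℤ) - (((A i).sum id : ℕ) : ℤ)) :
    dVal n A' = dVal n A + 2 * t * (t - u) ∧
      (t = u → dVal n A' = dVal n A) ∧
      (u < t → dVal n A < dVal n A') ∧
      (t < u → dVal n A' < dVal n A) := by
  have hdisj := hA.1 i j hij
  have hbi : b ∉ A i := fun h => Finset.disjoint_left.1 hdisj h hb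
  have haj : a ∉ A j := Finset.disjoint_left.1 hdisj ha
  have hi : (((A' i).sum id : ℕ) : ℤ) = (((A i).sum id : ℕ) : ℤ) + b - a := by
    rw [hA', Function.update_of_ne hij, Function.update_self, sum_insert_erase_cast ha hbi]
  have hj : (((A' j).sum id : ℕ) : ℤ) = (((A j).sum id : ℕ) : ℤ) + a - b := by
    rw [hA', Function.update_self, sum_insert_erase_cast hb haj]
  have key : dVal n A' = dVal n A + 2 * t * (t - u) := by
    have h := sum_sub_sum_of_eq_off_pair hij
      (fun l => ((((A' l).sum id : ℕ) : ℤ) - (magicConst n k : ℤ)) ^ 2)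
      (fun l => ((((A l).sum id : ℕ) : ℤ) - (magicConst n k : ℤ)) ^ 2)
      (fun l hli hlj => by
        simp only [hA', Function.update_of_ne hlj, Function.update_of_ne hli])
    rw [← sub_eq_iff_eq_add', dVal, dVal, h]
    simp only [hi, hj, ht, hu]
    ring
  have ht0 : 0 < t := by omega
  refine ⟨key, fun h => ?_, fun h => ?_, fun h => ?_⟩
  · rw [key, h]; ring
  · nlinarith [mul_pos ht0 (sub_pos.2 h)]
  · nlinarith [mul_pos ht0 (sub_pos.2 h)]
end

section
/- Let n and k be positive integers with k dividing n(n+1)/2, and let p_1 ≤ … ≤ p_k be positive integers with p_1+…+p_k = n. Suppose there is no equitable partition of [n] implementing (p_1,…,p_k), and let A be a minimal partition implementing (p_1,…,p_k). Then there is no c ∈ [n] such that c lies in a low set of A and c+1 lies in a high set of A. -/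
open Finset

/-- Exchanging the consecutive elements `c` and `c + 1` in a finite set changes its sum by `1`
if it contains `c` only, by `-1` if it contains `c + 1` only, and by `0` otherwise. -/
theorem sum_map_swap_succ (c : ℕ) (s : Finset ℕ) :
    (((s.map (Equiv.swap c (c + 1)).toEmbedding).sum id : ℕ) : ℤ) =
      ((s.sum id : ℕ) : ℤ) + (if c ∈ s then 1 else 0) - (if c + 1 ∈ s then 1 else 0) := by
  have h (x : ℕ) : ((Equiv.swap c (c + 1) x : ℕ) : ℤ) =
      (x : ℤ) + (if c = x then 1 else 0) - (if c + 1 = x then 1 else 0) := by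
    rw [Equiv.swap_apply_def]
    split_ifs <;> omega
  simp only [Finset.sum_map, Equiv.coe_toEmbedding, id, Nat.cast_sum, h,
    Finset.sum_sub_distrib, Finset.sum_add_distrib, Finset.sum_ite_eq]

/-- A permutation of `ℕ` preserving `[n]` maps partitions implementing `p` to partitions
implementing `p`. -/
theorem Implements.map {n k : ℕ} {A : Fin k → Finset ℕ} {p : Fin k → ℕ}
    (hA : Implements n A p) (σ : Equiv.Perm ℕ)
    (hσ : (Finset.Icc 1 n).map σ.toEmbedding = Finset.Icc 1 n) :
    Implements n (fun t => (A t).map σ.toEmbedding) p := by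
  obtain ⟨⟨hdisj, hunion⟩, e, he⟩ := hA
  refine ⟨⟨fun i j hij => (Finset.disjoint_map _).2 (hdisj i j hij), ?_⟩, e, fun i => ?_⟩
  · rw [← hσ, ← hunion]
    ext x
    simp only [Finset.mem_biUnion, Finset.mem_map, Finset.mem_univ, true_and]
    tauto
  · rw [Finset.card_map, he]

/-- Exchanging two elements of a finite set leaves it unchanged. -/
theorem map_swap_eq_self {s : Finset ℕ} {a b : ℕ} (ha : a ∈ s) (hb : b ∈ s) :
    s.map (Equiv.swap a b).toEmbedding = s := by
  refine Finset.eq_of_subset_of_card_le (fun x hx => ?_) (Finset.card_map _).ge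
  obtain ⟨y, hy, rfl⟩ := Finset.mem_map.1 hx
  rw [Equiv.coe_toEmbedding, Equiv.swap_apply_def]
  split_ifs <;> assumption

/-- If `c` lies in the part `i` and `c + 1` in another part `j`, exchanging them changes `d` by
`2 (S(A_i) - S(A_j) + 1)`. -/
theorem dVal_map_swap_succ {n k : ℕ} {A : Fin k → Finset ℕ}
    (hA : ∀ i j : Fin k, i ≠ j → Disjoint (A i) (A j)) {c : ℕ} {i j : Fin k} (hij : i ≠ j)
    (hi : c ∈ A i) (hj : c + 1 ∈ A j) :
    dVal n (fun t => (A t).map (Equiv.swap c (c + 1)).toEmbedding) =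
      dVal n A + 2 * ((((A i).sum id : ℕ) : ℤ) - (((A j).sum id : ℕ) : ℤ) + 1) := by
  have mem_iff {x : ℕ} {u : Fin k} (hu : x ∈ A u) (t : Fin k) : x ∈ A t ↔ u = t := by
    refine ⟨fun ht => ?_, fun h => h ▸ hu⟩
    by_contra h
    exact Finset.disjoint_left.1 (hA u t h) hu ht
  have key (t : Fin k) :
      ((((A t).map (Equiv.swap c (c + 1)).toEmbedding).sum id : ℕ) - (magicConst n k : ℤ)) ^ 2 =
        ((((A t).sum id : ℕ) : ℤ) - (magicConst n k : ℤ)) ^ 2 +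
        (if i = t then 2 * ((((A t).sum id : ℕ) : ℤ) - (magicConst n k : ℤ)) + 1 else 0) +
        (if j = t then 1 - 2 * ((((A t).sum id : ℕ) : ℤ) - (magicConst n k : ℤ)) else 0) := by
    simp only [sum_map_swap_succ, mem_iff hi, mem_iff hj]
    by_cases hit : i = t
    · have hjt : j ≠ t := fun h => hij (hit.trans h.symm)
      simp only [hit, hjt, if_true, if_false]
      ring
    · simp only [hit, if_false]
      split_ifs <;> ring
  simp only [dVal, key, Finset.sum_add_distrib, Finset.sum_ite_eq, Finset.mem_univ, if_true]
  ring

/-- in a minimal partition, no `c` lies in a low set with `c+1` in a high set. -/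
theorem stmt_7 (n k : ℕ) (hn : 0 < n) (hk : 0 < k) (hdvd : k ∣ n * (n + 1) / 2)
    (p : Fin k → ℕ) (hp : ∀ i, 0 < p i) (hmono : Monotone p)
    (hsum : ∑ i : Fin k, p i = n)
    (hne : ¬ ∃ B : Fin k → Finset ℕ, Implements n B p ∧ Equitable n B)
    (A : Fin k → Finset ℕ) (hA : MinimalPartition n A p) :
    ¬ ∃ (c : ℕ) (i j : Fin k), c ∈ A i ∧ c + 1 ∈ A j ∧
      (A i).sum id < magicConst n k ∧ magicConst n k < (A j).sum id := by
  rintro ⟨c, i, j, hi, hj, hlow, hhigh⟩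
  obtain ⟨himp, hmin⟩ := hA
  have hij : i ≠ j := by
    rintro rfl
    omega
  have mem_Icc {x : ℕ} {t : Fin k} (hx : x ∈ A t) : x ∈ Finset.Icc 1 n :=
    himp.1.2 ▸ Finset.mem_biUnion.2 ⟨t, Finset.mem_univ t, hx⟩
  have hle := hmin _ (himp.map _ (map_swap_eq_self (mem_Icc hi) (mem_Icc hj)))
  rw [dVal_map_swap_succ himp.1.1 hij hi hj] at hle
  omega
end

section
/- Let n and k be positive integers with k dividing n(n+1)/2, and let p_1 ≤ … ≤ p_k be positive integers with p_1+…+p_k = n satisfying condition (★). If there is no equitable partition of [n] implementing (p_1,…,p_k), then every minimal partition implementing (p_1,…,p_k) contains at least one exact set, at least one low set whose sum equals s^{n,k} − 1, and at least one high set whose sum equals s^{n,k} + 1. -/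
open Finset

namespace IsPartitionOn

variable {n k : ℕ} {A : Fin k → Finset ℕ}

theorem mem_Icc (hA : IsPartitionOn n A) {i : Fin k} {x : ℕ} (hx : x ∈ A i) : x ∈ Icc 1 n :=
  hA.2 ▸ mem_biUnion.2 ⟨i, mem_univ i, hx⟩

theorem exists_mem (hA : IsPartitionOn n A) {x : ℕ} (hx : x ∈ Icc 1 n) : ∃ i, x ∈ A i := by
  rw [← hA.2] at hx
  simpa using hx

theorem eq_of_mem (hA : IsPartitionOn n A) {i j : Fin k} {x : ℕ} (hi : x ∈ A i) (hj : x ∈ A j) :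
    i = j := by
  by_contra h
  exact disjoint_left.1 (hA.1 i j h) hi hj

theorem pairwiseDisjoint (hA : IsPartitionOn n A) (J : Set (Fin k)) : J.PairwiseDisjoint A :=
  fun i _ j _ h => hA.1 i j h

theorem sum_sum_eq (hA : IsPartitionOn n A) : ∑ i, (A i).sum id = n * (n + 1) / 2 := by
  rw [← sum_biUnion (hA.pairwiseDisjoint _), hA.2]
  have h : Icc 1 n = (range (n + 1)).erase 0 := by ext; simp; omega
  rw [h, sum_erase (range (n + 1)) (a := 0) (f := id) rfl]
  simpa [mul_comm] using sum_range_id (n + 1)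

end IsPartitionOn

/-- Exchanging two consecutive elements of different parts of a minimal partition does not
decrease `dVal`, so the sums of these parts cannot differ by more than one in the wrong
direction. -/
theorem MinimalPartition.sum_le_succ {n k : ℕ} {A : Fin k → Finset ℕ} {p : Fin k → ℕ}
    (hA : MinimalPartition n A p) {i j : Fin k} {x : ℕ} (hij : i ≠ j) (hi : x ∈ A i)
    (hj : x + 1 ∈ A j) : (A j).sum id ≤ (A i).sum id + 1 := by
  obtain ⟨⟨hpart, e, he⟩, hmin⟩ := hA
  let σ : Equiv.Perm ℕ := Equiv.swap x (x + 1)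
  let B : Fin k → Finset ℕ := fun l => (A l).map σ.toEmbedding
  have hB : Implements n B p := by
    refine ⟨⟨fun a b hab => (disjoint_map _).2 (hpart.1 a b hab), ?_⟩, e, fun l => by simp [B, he]⟩
    have hx := mem_Icc.1 (hpart.mem_Icc hi)
    have hx' := mem_Icc.1 (hpart.mem_Icc hj)
    have hU : univ.biUnion B = (univ.biUnion A).map σ.toEmbedding := by
      ext y; simp [B]
    rw [hU, hpart.2]
    refine eq_of_subset_of_card_le (fun y hy => ?_) (by simp)
    obtain ⟨z, hz, rfl⟩ := mem_map.1 hy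
    have hz := mem_Icc.1 hz
    simp only [Equiv.coe_toEmbedding, σ, Equiv.swap_apply_def, mem_Icc]
    split_ifs <;> omega
  have hmemi (l : Fin k) : x ∈ A l ↔ l = i :=
    ⟨fun h => hpart.eq_of_mem h hi, fun h => h ▸ hi⟩
  have hmemj (l : Fin k) : x + 1 ∈ A l ↔ l = j :=
    ⟨fun h => hpart.eq_of_mem h hj, fun h => h ▸ hj⟩
  have hS (l : Fin k) : (((B l).sum id : ℕ) : ℤ) =
      ((A l).sum id : ℕ) + (if l = i then 1 else 0) - (if l = j then 1 else 0) := by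
    have hσ (z : ℕ) : ((σ z : ℕ) : ℤ) =
        z + (if x = z then 1 else 0) - (if x + 1 = z then 1 else 0) := by
      simp only [σ, Equiv.swap_apply_def]
      split_ifs <;> push_cast <;> omega
    simp only [B, sum_map, Equiv.coe_toEmbedding, id, Nat.cast_sum, hσ, sum_sub_distrib,
      sum_add_distrib, sum_ite_eq, hmemi, hmemj]
  have hd := hmin B hB
  let D : Fin k → ℤ := fun l => ((A l).sum id : ℕ) - (magicConst n k : ℤ)
  have hdB : dVal n B = dVal n A + (2 * D i - 2 * D j + 2) := by
    have hterm (l : Fin k) : (((B l).sum id : ℕ) - (magicConst n k : ℤ)) ^ 2 =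
        D l ^ 2 + (if l = i then 2 * D l + 1 else 0) + (if l = j then -2 * D l + 1 else 0) := by
      rw [hS]
      split_ifs with h1 h2
      · exact absurd (h1.symm.trans h2) hij
      all_goals simp only [D]; ring
    simp only [dVal, hterm, sum_add_distrib, sum_ite_eq', mem_univ, if_true, D]
    ring
  simp only [D] at hdB
  omega

/-- Among the sets of `j + 1` indices, an initial segment minimizes the sum of a monotone
sequence. -/
theorem sum_Iic_le_sum_of_card_eq {k : ℕ} {p : Fin k → ℕ} (hp : Monotone p) (j : Fin k)
    {T : Finset (Fin k)} (hT : #T = j + 1) : ∑ t ∈ Iic j, p t ≤ ∑ t ∈ T, p t := by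
  have hcard : #(Iic j \ T) = #(T \ Iic j) :=
    card_sdiff_comm (by rw [hT, Fin.card_Iic])
  rw [← sum_inter_add_sum_sdiff (Iic j) T, ← sum_inter_add_sum_sdiff T (Iic j), inter_comm]
  refine Nat.add_le_add_left ?_ _
  calc ∑ t ∈ Iic j \ T, p t ≤ #(Iic j \ T) • p j :=
        sum_le_card_nsmul _ _ _ fun t ht => hp (mem_Iic.1 (mem_sdiff.1 ht).1)
    _ = #(T \ Iic j) • p j := by rw [hcard]
    _ ≤ ∑ t ∈ T \ Iic j, p t := card_nsmul_le_sum _ _ _ fun t ht => hp <|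
        (not_le.1 fun h => (mem_sdiff.1 ht).2 (mem_Iic.2 h)).le

/-- A set of elements of `[n]` that is closed under successors in `[n]` consists of the largest
elements of `[n]`. -/
theorem image_sub_range_card_eq {n : ℕ} {U : Finset ℕ} (hU : U ⊆ Icc 1 n)
    (hsucc : ∀ x ∈ U, x < n → x + 1 ∈ U) : (range #U).image (fun i => n - i) = U := by
  have hle : #U ≤ n := by simpa using card_le_card hU
  have hup {x y : ℕ} (hx : x ∈ U) (hxy : x ≤ y) : y ≤ n → y ∈ U := by
    induction y, hxy using Nat.le_induction with
    | base => exact fun _ => hx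
    | succ y _ ih => exact fun h => hsucc y (ih (by omega)) (by omega)
  refine eq_of_subset_of_card_le (fun y hy => ?_) ?_
  · obtain ⟨i, hi, rfl⟩ := mem_image.1 hy
    rw [mem_range] at hi
    by_contra h
    have hsub : U ⊆ Icc (n - i + 1) n := fun z hz => by
      have hzn := mem_Icc.1 (hU hz)
      rw [mem_Icc]
      refine ⟨?_, hzn.2⟩
      by_contra hlt
      exact h (hup hz (by omega) (by omega))
    have := card_le_card hsub
    rw [Nat.card_Icc] at this
    omega
  · rw [card_image_of_injOn, card_range]
    intro a ha b hb hab
    simp only [coe_range, Set.mem_Iio] at ha hb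
    simp only at hab
    omega

/-- Under the star condition, parts which together are closed under successors in `[n]` have
average sum at least the magic constant. -/
theorem StarCond.card_mul_le_sum {n k : ℕ} {p : Fin k → ℕ} (hstar : StarCond n k p)
    (hmono : Monotone p) {A : Fin k → Finset ℕ} (hA : Implements n A p) (J : Finset (Fin k))
    (hsucc : ∀ i ∈ J, ∀ j ∉ J, ∀ x ∈ A i, x + 1 ∉ A j) :
    #J * magicConst n k ≤ ∑ i ∈ J, (A i).sum id := by
  obtain ⟨hpart, e, he⟩ := hA
  obtain hJ | hJ := Nat.eq_zero_or_pos #J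
  · simp [hJ]
  have hJk : #J ≤ k := by simpa using card_le_univ J
  have hdisj := hpart.pairwiseDisjoint (J : Set (Fin k))
  have hU : J.biUnion A ⊆ Icc 1 n := biUnion_subset.2 fun i _ x hx => hpart.mem_Icc hx
  have himage := image_sub_range_card_eq hU fun x hx hxn => by
    obtain ⟨i, hi, hxi⟩ := mem_biUnion.1 hx
    obtain ⟨j, hj⟩ := hpart.exists_mem (x := x + 1) (mem_Icc.2 ⟨by omega, hxn⟩)
    by_contra h
    exact hsucc i hi j (fun hjJ => h (mem_biUnion.2 ⟨j, hjJ, hj⟩)) x hxi hj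
  have hcard : #(J.biUnion A) = ∑ t ∈ J.map e.symm.toEmbedding, p t := by
    rw [card_biUnion hdisj, sum_map]
    simp [← he]
  have hle : #(J.biUnion A) ≤ n := by simpa using card_le_card hU
  have hj := hstar ⟨#J - 1, by omega⟩
  have hP := sum_Iic_le_sum_of_card_eq hmono ⟨#J - 1, by omega⟩
    (T := J.map e.symm.toEmbedding) (by rw [card_map]; simp only; omega)
  rw [← hcard] at hP
  calc #J * magicConst n k = (#J - 1 + 1) * magicConst n k := by rw [Nat.sub_add_cancel hJ]
    _ ≤ _ := hj
    _ ≤ ∑ i ∈ range #(J.biUnion A), (n - i) :=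
        sum_le_sum_of_subset (range_subset_range.2 hP)
    _ = ((range #(J.biUnion A)).image (fun i => n - i)).sum id := by
        rw [sum_image]
        · rfl
        · intro a ha b hb hab
          simp only [coe_range, Set.mem_Iio] at ha hb
          simp only at hab
          omega
    _ = ∑ i ∈ J, (A i).sum id := by rw [himage, sum_biUnion hdisj]

/-- Lemma 2. -/
theorem stmt_9 (n k : ℕ) (hn : 0 < n) (hk : 0 < k) (hdvd : k ∣ n * (n + 1) / 2)
    (p : Fin k → ℕ) (hp : ∀ i, 0 < p i) (hmono : Monotone p)
    (hsum : ∑ i : Fin k, p i = n) (hstar : StarCond n k p)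
    (hne : ¬ ∃ B : Fin k → Finset ℕ, Implements n B p ∧ Equitable n B) :
    ∀ A : Fin k → Finset ℕ, MinimalPartition n A p →
      (∃ i : Fin k, (A i).sum id = magicConst n k) ∧
      (∃ i : Fin k, (A i).sum id + 1 = magicConst n k) ∧
      (∃ i : Fin k, (A i).sum id = magicConst n k + 1) := by
  intro A hA
  set s := magicConst n k with hs
  have hlow : ∃ i, (A i).sum id < s := by
    by_contra! h
    have hks : ∑ _i : Fin k, s = ∑ i, (A i).sum id := by
      rw [hA.1.1.sum_sum_eq]
      simpa [hs, magicConst] using Nat.mul_div_cancel' hdvd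
    have heq := (sum_eq_sum_iff_of_le fun i _ => h i).1 hks
    exact hne ⟨A, hA.1, fun i => (heq i (mem_univ i)).symm⟩
  obtain ⟨l, hl⟩ := hlow
  have key (J : Finset (Fin k)) (hlJ : l ∈ J) (hJ : ∀ i ∈ J, (A i).sum id ≤ s) :
      ∃ i ∈ J, ∃ j ∉ J, (A j).sum id ≤ (A i).sum id + 1 := by
    by_contra! h
    have hle := hstar.card_mul_le_sum hmono hA.1 J fun i hi j hj x hxi hxj =>
      (h i hi j hj).not_ge (hA.sum_le_succ (ne_of_mem_of_not_mem hi hj) hxi hxj)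
    have hlt : ∑ i ∈ J, (A i).sum id < ∑ _i ∈ J, s := sum_lt_sum hJ ⟨l, hlJ, hl⟩
    rw [sum_const, smul_eq_mul] at hlt
    exact hle.not_gt hlt
  obtain ⟨i, hi, j, hj, hij⟩ := key {i | (A i).sum id < s} (by simpa using hl)
    fun i hi => (mem_filter.1 hi).2.le
  obtain ⟨i', hi', j', hj', hij'⟩ := key {i | (A i).sum id ≤ s} (by simpa using hl.le)
    fun i hi => (mem_filter.1 hi).2
  simp only [mem_filter, mem_univ, true_and] at hi hj hi' hj'
  exact ⟨⟨j, by omega⟩, ⟨i, by omega⟩, ⟨j', by omega⟩⟩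
end

section
/- Under the Lemma 6 setup (see context), the set A₀ ∖ {x+1} contains no element a such that a + 1 ∈ X ∖ {x}. -/
open Finset

/-- The permutation of `ℕ` that exchanges `x` with `x + 1` and then `a` with `a + 1`. -/
def adjacentSwaps (x a : ℕ) : Equiv.Perm ℕ :=
  (Equiv.swap x (x + 1)).trans (Equiv.swap a (a + 1))

/-- Apply a permutation to every part of a family of sets. -/
def mapParts {k : ℕ} (σ : Equiv.Perm ℕ) (A : Fin k → Finset ℕ) : Fin k → Finset ℕ :=
  fun i => (A i).map σ.toEmbedding

theorem adjacentSwaps_apply (x a z : ℕ) :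
    adjacentSwaps x a z = Equiv.swap a (a + 1) (Equiv.swap x (x + 1) z) := rfl

theorem adjacentSwaps_mem {S : Finset ℕ} {x a : ℕ} (hx : x ∈ S) (hx' : x + 1 ∈ S)
    (ha : a ∈ S) (ha' : a + 1 ∈ S) : ∀ z ∈ S, adjacentSwaps x a z ∈ S := by
  intro z hz
  simp only [adjacentSwaps_apply, Equiv.swap_apply_def]
  split_ifs <;> assumption

theorem cast_adjacentSwaps {x a : ℕ} (h₁ : x ≠ a) (h₂ : a ≠ x + 1) (h₃ : a + 1 ≠ x) (z : ℕ) :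
    (adjacentSwaps x a z : ℤ) = z + (if z = x then 1 else 0) - (if z = x + 1 then 1 else 0)
      + (if z = a then 1 else 0) - (if z = a + 1 then 1 else 0) := by
  simp only [adjacentSwaps_apply, Equiv.swap_apply_def]
  grind

theorem sum_map_adjacentSwaps {S : Finset ℕ} {x a : ℕ} (h₁ : x ≠ a) (h₂ : a ≠ x + 1)
    (h₃ : a + 1 ≠ x) (hxa : x ∈ S ↔ a + 1 ∈ S) (hax : x + 1 ∈ S ↔ a ∈ S) :
    (S.map (adjacentSwaps x a).toEmbedding).sum id = S.sum id := by
  zify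
  simp only [Finset.sum_map, Equiv.coe_toEmbedding, id, cast_adjacentSwaps h₁ h₂ h₃,
    Finset.sum_add_distrib, Finset.sum_sub_distrib, Finset.sum_ite_eq', hxa, hax]
  ring

theorem IsPartitionOn.mapParts {n k : ℕ} {A : Fin k → Finset ℕ} (hA : IsPartitionOn n A)
    {σ : Equiv.Perm ℕ} (hσ : ∀ z ∈ Finset.Icc 1 n, σ z ∈ Finset.Icc 1 n) :
    IsPartitionOn n (mapParts σ A) := by
  refine ⟨fun i j hij => (Finset.disjoint_map _).2 (hA.1 i j hij), ?_⟩
  refine Finset.eq_of_subset_of_card_le ?_ ?_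
  · intro z hz
    obtain ⟨i, -, hi⟩ := Finset.mem_biUnion.1 hz
    obtain ⟨w, hw, rfl⟩ := Finset.mem_map.1 hi
    exact hσ w (hA.2 ▸ Finset.mem_biUnion.2 ⟨i, Finset.mem_univ i, hw⟩)
  · rw [← hA.2, ← Finset.card_map σ.toEmbedding]
    refine Finset.card_le_card fun z hz => ?_
    obtain ⟨w, hw, rfl⟩ := Finset.mem_map.1 hz
    obtain ⟨i, hi, hwi⟩ := Finset.mem_biUnion.1 hw
    exact Finset.mem_biUnion.2 ⟨i, hi, Finset.mem_map_of_mem _ hwi⟩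

theorem MinimalPartition.mapParts {n k : ℕ} {A : Fin k → Finset ℕ} {p : Fin k → ℕ}
    (hA : MinimalPartition n A p) {σ : Equiv.Perm ℕ}
    (hσ : ∀ z ∈ Finset.Icc 1 n, σ z ∈ Finset.Icc 1 n)
    (hsum : ∀ i, (mapParts σ A i).sum id = (A i).sum id) :
    MinimalPartition n (mapParts σ A) p := by
  obtain ⟨⟨hpart, e, he⟩, hmin⟩ := hA
  refine ⟨⟨hpart.mapParts hσ, e, fun i => (Finset.card_map _).trans (he i)⟩, fun B hB => ?_⟩
  have hd : dVal n (_root_.mapParts σ A) = dVal n A := by simp only [dVal, hsum]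
  exact hd ▸ hmin B hB

/-- Lemma 6(iii). -/
theorem stmt_15 (n : ℕ) (hn : 0 < n) (hdvd : 4 ∣ n * (n + 1) / 2)
    (p : Fin 4 → ℕ) (hp : ∀ i, 0 < p i)
    (X Y Z W : Finset ℕ)
    (hmin : MinimalPartition n ![X, Y, Z, W] p)
    (hminw : ∀ B : Fin 4 → Finset ℕ, MinimalPartition n B p →
      width n ![X, Y, Z, W] ≤ width n B)
    (hfin : width n ![X, Y, Z, W] ≠ ⊤)
    (hX : X.sum id + 1 = magicConst n 4)
    (hY : Y.sum id = magicConst n 4 + 1)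
    (hZ : Z.sum id = magicConst n 4) (hW : W.sum id = magicConst n 4)
    (x y : ℕ) (hx : x ∈ X) (hy : y ∈ Y) (hxy : x < y)
    (hw : width n ![X, Y, Z, W] = ((y - x : ℕ) : ℕ∞))
    (A₀ B₀ : Finset ℕ) (hA₀ : A₀ = Z ∨ A₀ = W) (hB₀ : B₀ = Z ∨ B₀ = W)
    (hxA : x + 1 ∈ A₀) (hyB : y - 1 ∈ B₀) :
    ∀ a : ℕ, a ∈ A₀ → a ≠ x + 1 → a + 1 ∈ X → a + 1 = x := by
  intro a ha hax haX
  by_contra hne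
  obtain ⟨j, hj, hj0⟩ : ∃ j : Fin 4, ![X, Y, Z, W] j = A₀ ∧ (j = 2 ∨ j = 3) := by
    rcases hA₀ with rfl | rfl
    · exact ⟨2, rfl, Or.inl rfl⟩
    · exact ⟨3, rfl, Or.inr rfl⟩
  have hdisj := hmin.1.1.1
  have mem_unique : ∀ {i i' : Fin 4} {z : ℕ}, z ∈ ![X, Y, Z, W] i → z ∈ ![X, Y, Z, W] i' →
      i = i' := by
    intro i i' z h h'
    by_contra hii
    exact Finset.disjoint_left.1 (hdisj i i' hii) h h'
  have hx0 : x ∈ ![X, Y, Z, W] 0 := hx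
  have ha0 : a + 1 ∈ ![X, Y, Z, W] 0 := haX
  have hy1 : y ∈ ![X, Y, Z, W] 1 := hy
  rw [← hj] at hxA ha
  have hj_zero : j ≠ 0 := by rcases hj0 with rfl | rfl <;> decide
  have hj_one : j ≠ 1 := by rcases hj0 with rfl | rfl <;> decide
  have hxa : x ≠ a := fun h => hj_zero (mem_unique (h ▸ ha) hx0)
  have hxy' : x + 1 ≠ y := fun h => hj_one (mem_unique hxA (h ▸ hy1))
  have hya : y ≠ a := fun h => hj_one (mem_unique ha (h ▸ hy1))
  have hya' : y ≠ a + 1 := fun h => zero_ne_one (mem_unique ha0 (h ▸ hy1))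
  have hsum : ∀ i, (mapParts (adjacentSwaps x a) ![X, Y, Z, W] i).sum id =
      (![X, Y, Z, W] i).sum id := fun i =>
    sum_map_adjacentSwaps hxa hax hne
      ⟨fun h => mem_unique hx0 h ▸ ha0, fun h => mem_unique ha0 h ▸ hx0⟩
      ⟨fun h => mem_unique hxA h ▸ ha, fun h => mem_unique ha h ▸ hxA⟩
  have hN : ∀ {i : Fin 4} {z : ℕ}, z ∈ ![X, Y, Z, W] i → z ∈ Finset.Icc 1 n := fun {i z} h =>
    hmin.1.1.2 ▸ Finset.mem_biUnion.2 ⟨i, Finset.mem_univ i, h⟩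
  have hB : MinimalPartition n (mapParts (adjacentSwaps x a) ![X, Y, Z, W]) p :=
    hmin.mapParts (adjacentSwaps_mem (hN hx0) (hN hxA) (hN ha) (hN ha0)) hsum
  have hwB : width n (mapParts (adjacentSwaps x a) ![X, Y, Z, W]) ≤ ((y - (x + 1) : ℕ) : ℕ∞) := by
    refine sInf_le ⟨x + 1, y, 0, 1, ?_, ?_, by omega, ?_, ?_, rfl⟩
    · refine Finset.mem_map.2 ⟨x, hx0, ?_⟩
      simp only [Equiv.coe_toEmbedding, adjacentSwaps_apply]
      grind
    · refine Finset.mem_map.2 ⟨y, hy1, ?_⟩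
      simp only [Equiv.coe_toEmbedding, adjacentSwaps_apply]
      grind
    · rw [hsum]
      change X.sum id < magicConst n 4
      omega
    · rw [hsum]
      change magicConst n 4 < Y.sum id
      omega
  have hle := (hw ▸ hminw _ hB).trans hwB
  rw [Nat.cast_le] at hle
  omega
end

section
/- Under the Lemma 6 setup (see context), the set B₀ ∖ {y−1} contains no element b such that b − 1 ∈ Y ∖ {y}. -/
open Finset

/-- Relabelling the parts of a partition of `[n]` by a permutation that preserves `[n]` gives a
partition implementing the same sizes. -/
theorem Implements.image_perm {n k : ℕ} {A : Fin k → Finset ℕ} {p : Fin k → ℕ}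
    (h : Implements n A p) (σ : Equiv.Perm ℕ) (hσ : ∀ t ∈ Finset.Icc 1 n, σ t ∈ Finset.Icc 1 n) :
    Implements n (fun i => (A i).image σ) p := by
  obtain ⟨⟨hd, hu⟩, e, he⟩ := h
  refine ⟨⟨fun i j hij => ?_, ?_⟩, e, fun i => ?_⟩
  · exact (Finset.disjoint_image σ.injective).2 (hd i j hij)
  · rw [← Finset.biUnion_image, hu]
    refine Finset.eq_of_subset_of_card_le (fun t ht => ?_) ?_
    · obtain ⟨u, hu, rfl⟩ := Finset.mem_image.1 ht
      exact hσ u hu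
    · rw [Finset.card_image_of_injective _ σ.injective]
  · simp only [Finset.card_image_of_injective _ σ.injective, he]

/-- A partition implementing `p` with the same part sums as a minimal one is minimal. -/
theorem MinimalPartition.of_sum_eq {n k : ℕ} {A B : Fin k → Finset ℕ} {p : Fin k → ℕ}
    (hA : MinimalPartition n A p) (hB : Implements n B p)
    (h : ∀ i, (B i).sum id = (A i).sum id) : MinimalPartition n B p := by
  refine ⟨hB, fun C hC => ?_⟩
  have : dVal n B = dVal n A := by simp only [dVal, h]
  exact this ▸ hA.2 C hC

/-- The sum of the image of a finite set under two disjoint transpositions, each of which moves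
exactly one element of the set. -/
theorem sum_image_swap_mul_swap {S : Finset ℕ} {a a' b b' : ℕ} (ha : a ∈ S) (hb : b ∈ S)
    (ha' : a' ∉ S) (hb' : b' ∉ S) (hab : a ≠ b) (hab' : a' ≠ b') :
    (S.image (Equiv.swap a a' * Equiv.swap b b')).sum id + (a + b) = S.sum id + (a' + b') := by
  have hba' : b ≠ a' := fun h => ha' (h ▸ hb)
  have hb'a : b' ≠ a := fun h => hb' (h ▸ ha)
  rw [Finset.sum_image (Equiv.injective _).injOn]
  rw [← Finset.add_sum_erase S _ ha, ← Finset.add_sum_erase S id ha]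
  have hbS : b ∈ S.erase a := Finset.mem_erase.2 ⟨hab.symm, hb⟩
  rw [← Finset.add_sum_erase _ _ hbS, ← Finset.add_sum_erase _ id hbS]
  have hrest : ∑ t ∈ (S.erase a).erase b, id ((Equiv.swap a a' * Equiv.swap b b') t) =
      ∑ t ∈ (S.erase a).erase b, id t := by
    refine Finset.sum_congr rfl fun t ht => ?_
    simp only [Finset.mem_erase] at ht
    obtain ⟨htb, hta, ht⟩ := ht
    have h1 : t ≠ a' := fun h => ha' (h ▸ ht)
    have h2 : t ≠ b' := fun h => hb' (h ▸ ht)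
    simp [Equiv.swap_apply_of_ne_of_ne htb h2, Equiv.swap_apply_of_ne_of_ne hta h1]
  rw [hrest]
  have h1 : (Equiv.swap a a' * Equiv.swap b b') a = a' := by
    simp [Equiv.swap_apply_of_ne_of_ne hab hb'a.symm]
  have h2 : (Equiv.swap a a' * Equiv.swap b b') b = b' := by
    simp [Equiv.swap_apply_of_ne_of_ne hb'a hab'.symm]
  rw [h1, h2]
  simp only [id]
  ring

/-- The image of a set under two transpositions moving no element of it. -/
theorem image_swap_mul_swap_eq_self {S : Finset ℕ} {a a' b b' : ℕ} (ha : a ∉ S) (hb : b ∉ S)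
    (ha' : a' ∉ S) (hb' : b' ∉ S) : S.image (Equiv.swap a a' * Equiv.swap b b') = S := by
  have h : ∀ t ∈ S, (Equiv.swap a a' * Equiv.swap b b') t = id t := fun t ht => by
    have h1 : t ≠ a := fun h => ha (h ▸ ht)
    have h2 : t ≠ a' := fun h => ha' (h ▸ ht)
    have h3 : t ≠ b := fun h => hb (h ▸ ht)
    have h4 : t ≠ b' := fun h => hb' (h ▸ ht)
    simp [Equiv.swap_apply_of_ne_of_ne h3 h4, Equiv.swap_apply_of_ne_of_ne h1 h2]
  rw [Finset.image_congr (fun t ht => h t ht), Finset.image_id]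

/-- In a minimal partition of minimal width `y - x`, attained by `x` in a low part and `y` in a
high part `j`, another part `m` containing `y - 1` has no `c + 1 ≠ y - 1` with `c ∈ A j \ {y}`:
exchanging `y, c` with `y - 1, c + 1` would keep all sums and shrink the width. -/
theorem succ_eq_pred_of_width_minimal {n k : ℕ} {A : Fin k → Finset ℕ} {p : Fin k → ℕ}
    (hmin : MinimalPartition n A p)
    (hminw : ∀ B : Fin k → Finset ℕ, MinimalPartition n B p → width n A ≤ width n B)
    {i j m : Fin k} (him : i ≠ m) (hjm : j ≠ m)
    (hi : (A i).sum id < magicConst n k) (hj : magicConst n k < (A j).sum id)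
    {x y c : ℕ} (hx : x ∈ A i) (hy : y ∈ A j) (hxy : x < y)
    (hw : width n A = ((y - x : ℕ) : ℕ∞)) (hym : y - 1 ∈ A m)
    (hc : c ∈ A j) (hcy : c ≠ y) (hcm : c + 1 ∈ A m) : c + 1 = y - 1 := by
  by_contra hne
  have hij : i ≠ j := by
    rintro rfl
    exact absurd hi hj.not_gt
  have hdis : ∀ {a b : Fin k} {t : ℕ}, t ∈ A a → a ≠ b → t ∉ A b := fun {a b t} ht hab =>
    Finset.disjoint_left.1 (hmin.1.1.1 a b hab) ht
  have hIcc : ∀ {a : Fin k} {t : ℕ}, t ∈ A a → t ∈ Finset.Icc 1 n := fun {a t} ht =>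
    hmin.1.1.2 ▸ Finset.mem_biUnion.2 ⟨a, Finset.mem_univ a, ht⟩
  set σ : Equiv.Perm ℕ := Equiv.swap y (y - 1) * Equiv.swap c (c + 1) with hσ
  have hσ' : Equiv.swap (y - 1) y * Equiv.swap (c + 1) c = σ := by
    rw [hσ, Equiv.swap_comm y, Equiv.swap_comm c]
  have hB : Implements n (fun i => (A i).image σ) p := by
    refine hmin.1.image_perm σ fun t ht => ?_
    have h1 := hIcc hy
    have h2 := hIcc hym
    have h3 := hIcc hc
    have h4 := hIcc hcm
    rw [hσ, Equiv.Perm.mul_apply, Equiv.swap_apply_def c, Equiv.swap_apply_def y]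
    split_ifs <;> assumption
  have hfix : ∀ a, a ≠ j → a ≠ m → (A a).image σ = A a := fun a haj ham =>
    image_swap_mul_swap_eq_self (hdis hy haj.symm) (hdis hc haj.symm) (hdis hym ham.symm)
      (hdis hcm ham.symm)
  have hsum : ∀ a, ((A a).image σ).sum id = (A a).sum id := fun a => by
    by_cases haj : a = j
    · subst haj
      have := sum_image_swap_mul_swap hy hc (hdis hym hjm.symm) (hdis hcm hjm.symm) hcy.symm
        (Ne.symm hne)
      rw [← hσ] at this
      omega
    by_cases ham : a = m
    · subst ham
      have := sum_image_swap_mul_swap hym hcm (hdis hy hjm) (hdis hc hjm) (Ne.symm hne)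
        hcy.symm
      rw [hσ'] at this
      omega
    rw [hfix a haj ham]
  have hxy' : x ≠ y - 1 := fun h => hdis hx him (h ▸ hym)
  have hle : width n (fun i => (A i).image σ) ≤ ((y - 1 - x : ℕ) : ℕ∞) := by
    refine sInf_le ⟨x, y - 1, i, j, ?_, ?_, by omega, ?_, ?_, rfl⟩
    · exact (Finset.ext_iff.1 (hfix i hij him) x).2 hx
    · refine Finset.mem_image.2 ⟨y, hy, ?_⟩
      have hyc : y ≠ c + 1 := fun h => hdis hy hjm (h ▸ hcm)
      simp [hσ, Equiv.swap_apply_of_ne_of_ne hcy.symm hyc]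
    · exact (hsum i).trans_lt hi
    · exact hj.trans_eq (hsum j).symm
  have := (hminw _ (hmin.of_sum_eq hB hsum)).trans hle
  rw [hw, Nat.cast_le] at this
  omega

/-- Lemma 6(v). -/
theorem stmt_17 (n : ℕ) (hn : 0 < n) (hdvd : 4 ∣ n * (n + 1) / 2)
    (p : Fin 4 → ℕ) (hp : ∀ i, 0 < p i)
    (X Y Z W : Finset ℕ)
    (hmin : MinimalPartition n ![X, Y, Z, W] p)
    (hminw : ∀ B : Fin 4 → Finset ℕ, MinimalPartition n B p →
      width n ![X, Y, Z, W] ≤ width n B)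
    (hfin : width n ![X, Y, Z, W] ≠ ⊤)
    (hX : X.sum id + 1 = magicConst n 4)
    (hY : Y.sum id = magicConst n 4 + 1)
    (hZ : Z.sum id = magicConst n 4) (hW : W.sum id = magicConst n 4)
    (x y : ℕ) (hx : x ∈ X) (hy : y ∈ Y) (hxy : x < y)
    (hw : width n ![X, Y, Z, W] = ((y - x : ℕ) : ℕ∞))
    (A₀ B₀ : Finset ℕ) (hA₀ : A₀ = Z ∨ A₀ = W) (hB₀ : B₀ = Z ∨ B₀ = W)
    (hxA : x + 1 ∈ A₀) (hyB : y - 1 ∈ B₀) :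
    ∀ c : ℕ, c ∈ Y → c ≠ y → c + 1 ∈ B₀ → c + 1 = y - 1 := by
  intro c hc hcy hcB
  have hi : (![X, Y, Z, W] 0).sum id < magicConst n 4 := by
    change X.sum id < _
    omega
  have hj : magicConst n 4 < (![X, Y, Z, W] 1).sum id := by
    change _ < Y.sum id
    omega
  rcases hB₀ with rfl | rfl
  · exact succ_eq_pred_of_width_minimal (i := 0) (j := 1) (m := 2) hmin hminw (by decide)
      (by decide) hi hj hx hy hxy hw hyB hc hcy hcB
  · exact succ_eq_pred_of_width_minimal (i := 0) (j := 1) (m := 3) hmin hminw (by decide)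
      (by decide) hi hj hx hy hxy hw hyB hc hcy hcB
end
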